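/- arXiv:2111.12343 — 7 statements merged into one kernel-verified Lean document; each statement's English description precedes it below -/
import Mathlib

section
/- Godsil–McKay switching: Let G be a finite simple graph and let {X_1, …, X_ℓ, Y} be a partition of V(G) such that (a) for every vertex x ∈ Y and every i ∈ {1,…,ℓ}, x has either 0, |X_i|/2, or |X_i| neighbors in X_i, and (b) for all i, j ∈ {1,…,ℓ}, the number of neighbors in X_j of a vertex of X_i depends only on i and j and not on the vertex. Let G' be the graph obtained from G as follows: for each x ∈ Y and each i such that x has exactly |X_i|/2 neighbors in X_i, delete those |X_i|/2 edges and join x instead to the other |X_i|/2 vertices of X_i. Then G and G' are cospectral with respect to the adjacency matrix, and their complements are also cospectral with respect to the adjacency matrix. -/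
open SimpleGraph Matrix Finset
open scoped Classical

/-- The switching matrix of a partition `{X_1, …, X_ℓ, Y}`: block diagonal, with blocks
`(2 / |X_i|) J - I` on the `X_i` and the identity on `Y`. -/
noncomputable def switchingMatrix {V ι : Type*} [Fintype ι] [DecidableEq V]
    (X : ι → Finset V) (Y : Finset V) : Matrix V V ℝ :=
  Matrix.diagonal (fun x => if x ∈ Y then 1 else -1) +
    Matrix.of fun x y => ∑ i, if x ∈ X i ∧ y ∈ X i then 2 / ((X i).card : ℝ) else 0

theorem switchingMatrix_transpose {V ι : Type*} [Fintype ι] [DecidableEq V]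
    {X : ι → Finset V} {Y : Finset V} : (switchingMatrix X Y)ᵀ = switchingMatrix X Y := by
  simp only [switchingMatrix, Matrix.transpose_add, Matrix.diagonal_transpose]
  congr 1
  ext x y
  simp [and_comm]

section SwitchingMatrix

variable {V ι : Type*} [Fintype V] [Fintype ι] [DecidableEq V] {X : ι → Finset V} {Y : Finset V}

theorem switchingMatrix_mul_apply_of_mem_right (hXY : ∀ i, Disjoint (X i) Y)
    (M : Matrix V V ℝ) {x : V} (hx : x ∈ Y) (z : V) :
    (switchingMatrix X Y * M) x z = M x z := by
  have h : ∀ i, x ∉ X i := fun i hi => Finset.disjoint_left.1 (hXY i) hi hx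
  rw [switchingMatrix, Matrix.add_mul, Matrix.add_apply, Matrix.diagonal_mul]
  simp [Matrix.mul_apply, h, hx]

theorem switchingMatrix_mul_apply_of_mem_left (hXX : ∀ i j, i ≠ j → Disjoint (X i) (X j))
    (hXY : ∀ i, Disjoint (X i) Y) (M : Matrix V V ℝ) {i : ι} {x : V} (hx : x ∈ X i) (z : V) :
    (switchingMatrix X Y * M) x z = 2 / ((X i).card : ℝ) * ∑ y ∈ X i, M y z - M x z := by
  have hY : x ∉ Y := Finset.disjoint_left.1 (hXY i) hx
  have h : ∀ y, (∑ j, if x ∈ X j ∧ y ∈ X j then 2 / ((X j).card : ℝ) else 0) =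
      if y ∈ X i then 2 / ((X i).card : ℝ) else 0 := by
    intro y
    rw [Finset.sum_eq_single i]
    · simp [hx]
    · intro j _ hj
      rw [if_neg]
      exact fun h => Finset.disjoint_left.1 (hXX j i hj) h.1 hx
    · simp
  rw [switchingMatrix, Matrix.add_mul, Matrix.add_apply, Matrix.diagonal_mul]
  simp only [Matrix.mul_apply, Matrix.of_apply, h, hY, ite_mul, zero_mul, Finset.sum_ite_mem,
    Finset.univ_inter, Finset.mul_sum, if_false]
  ring

theorem mul_switchingMatrix_apply (M : Matrix V V ℝ) (x z : V) :
    (M * switchingMatrix X Y) x z = (switchingMatrix X Y * Mᵀ) z x := by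
  rw [← Matrix.transpose_apply (M * switchingMatrix X Y), Matrix.transpose_mul,
    switchingMatrix_transpose]

theorem switchingMatrix_mul_of_one (hXX : ∀ i j, i ≠ j → Disjoint (X i) (X j))
    (hXY : ∀ i, Disjoint (X i) Y) (hcover : ∀ v, v ∈ Y ∨ ∃ i, v ∈ X i) :
    switchingMatrix X Y * Matrix.of (fun _ _ => 1) = Matrix.of (fun _ _ => 1) := by
  ext x z
  obtain hx | ⟨i, hx⟩ := hcover x
  · rw [switchingMatrix_mul_apply_of_mem_right hXY _ hx]
  · have : ((X i).card : ℝ) ≠ 0 := by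
      exact_mod_cast Finset.card_ne_zero_of_mem hx
    rw [switchingMatrix_mul_apply_of_mem_left hXX hXY _ hx]
    simp only [Matrix.of_apply, Finset.sum_const, nsmul_eq_mul]
    field_simp
    norm_num

theorem of_one_mul_switchingMatrix (hXX : ∀ i j, i ≠ j → Disjoint (X i) (X j))
    (hXY : ∀ i, Disjoint (X i) Y) (hcover : ∀ v, v ∈ Y ∨ ∃ i, v ∈ X i) :
    Matrix.of (fun _ _ => 1) * switchingMatrix X Y = Matrix.of (fun _ _ => 1) := by
  ext x z
  rw [mul_switchingMatrix_apply]
  exact congrFun₂ (switchingMatrix_mul_of_one hXX hXY hcover) z x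

theorem switchingMatrix_mul_self (hXX : ∀ i j, i ≠ j → Disjoint (X i) (X j))
    (hXY : ∀ i, Disjoint (X i) Y) (hcover : ∀ v, v ∈ Y ∨ ∃ i, v ∈ X i) :
    switchingMatrix X Y * switchingMatrix X Y = 1 := by
  have h1 : ∀ x z, switchingMatrix X Y x z = (switchingMatrix X Y * (1 : Matrix V V ℝ)) x z := by
    simp
  ext x z
  obtain hx | ⟨i, hx⟩ := hcover x
  · rw [switchingMatrix_mul_apply_of_mem_right hXY _ hx, h1,
      switchingMatrix_mul_apply_of_mem_right hXY _ hx]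
  · have hc : ((X i).card : ℝ) ≠ 0 := by
      exact_mod_cast Finset.card_ne_zero_of_mem hx
    have h2 : ∀ y ∈ X i, switchingMatrix X Y y z =
        2 / ((X i).card : ℝ) * ∑ w ∈ X i, (1 : Matrix V V ℝ) w z - (1 : Matrix V V ℝ) y z :=
      fun y hy => by rw [h1, switchingMatrix_mul_apply_of_mem_left hXX hXY _ hy]
    rw [switchingMatrix_mul_apply_of_mem_left hXX hXY _ hx, Finset.sum_congr rfl h2, h2 x hx,
      Finset.sum_sub_distrib, Finset.sum_const, nsmul_eq_mul]
    field_simp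
    ring

/-- The switching matrix intertwines two symmetric matrices as soon as their entries agree on the
blocks inside `Y` and inside the union of the `X_i`, the row sums of the blocks between the `X_i`
are constant, and each row between `Y` and `X_i` is replaced by its reflection about its mean. -/
theorem switchingMatrix_mul_eq_mul_switchingMatrix
    (hXX : ∀ i j, i ≠ j → Disjoint (X i) (X j))
    (hXY : ∀ i, Disjoint (X i) Y) (hcover : ∀ v, v ∈ Y ∨ ∃ i, v ∈ X i)
    {A B : Matrix V V ℝ} (hA : A.IsSymm) (hB : B.IsSymm)
    (hreg : ∀ i j, ∀ x ∈ X i, ∀ y ∈ X i, ∑ z ∈ X j, A x z = ∑ z ∈ X j, A y z)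
    (hYY : ∀ x ∈ Y, ∀ y ∈ Y, B x y = A x y)
    (hXadj : ∀ i j, ∀ x ∈ X i, ∀ y ∈ X j, B x y = A x y)
    (hswitch : ∀ x ∈ Y, ∀ i, ∀ y ∈ X i,
      B x y = 2 / ((X i).card : ℝ) * ∑ z ∈ X i, A x z - A x y) :
    switchingMatrix X Y * A = B * switchingMatrix X Y := by
  ext x z
  rw [mul_switchingMatrix_apply, hB]
  obtain hx | ⟨i, hx⟩ := hcover x <;> obtain hz | ⟨j, hz⟩ := hcover z
  · rw [switchingMatrix_mul_apply_of_mem_right hXY _ hx,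
      switchingMatrix_mul_apply_of_mem_right hXY _ hz, hYY z hz x hx, hA.apply]
  · have hc : ((X j).card : ℝ) ≠ 0 := by
      exact_mod_cast Finset.card_ne_zero_of_mem hz
    rw [switchingMatrix_mul_apply_of_mem_right hXY _ hx,
      switchingMatrix_mul_apply_of_mem_left hXX hXY _ hz, hB.apply,
      Finset.sum_congr rfl fun y _ => hB.apply x y,
      Finset.sum_congr rfl (hswitch x hx j), hswitch x hx j z hz,
      Finset.sum_sub_distrib, Finset.sum_const, nsmul_eq_mul]
    field_simp
    ring
  · rw [switchingMatrix_mul_apply_of_mem_left hXX hXY _ hx,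
      switchingMatrix_mul_apply_of_mem_right hXY _ hz, hswitch z hz i x hx, hA.apply z x,
      Finset.sum_congr rfl fun y _ => hA.apply z y]
  · have hi : ((X i).card : ℝ) ≠ 0 := by
      exact_mod_cast Finset.card_ne_zero_of_mem hx
    have hj : ((X j).card : ℝ) ≠ 0 := by
      exact_mod_cast Finset.card_ne_zero_of_mem hz
    have hcount : ((X i).card : ℝ) * ∑ y ∈ X j, A x y = (X j).card * ∑ y ∈ X i, A z y := by
      have h1 := Finset.sum_congr rfl fun u hu => hreg i j u hu x hx
      have h2 := Finset.sum_congr rfl fun u hu => hreg j i u hu z hz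
      rw [Finset.sum_const, nsmul_eq_mul] at h1 h2
      rw [← h1, ← h2]
      refine (Finset.sum_congr rfl fun u _ => Finset.sum_congr rfl fun w _ => ?_).trans
        Finset.sum_comm
      exact hA.apply w u
    rw [switchingMatrix_mul_apply_of_mem_left hXX hXY _ hx,
      switchingMatrix_mul_apply_of_mem_left hXX hXY _ hz, hXadj j i z hz x hx, hA.apply x z,
      Finset.sum_congr rfl fun y hy => hXadj j i y hy x hx |>.trans (hA.apply x y),
      Finset.sum_congr rfl fun y _ => hA.apply z y]
    field_simp
    linear_combination -2 * hcount

end SwitchingMatrix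

theorem Matrix.charpoly_eq_of_involution_intertwines {n R : Type*} [Fintype n] [DecidableEq n]
    [CommRing R] {Q A B : Matrix n n R} (hQ : Q * Q = 1) (h : Q * A = B * Q) :
    A.charpoly = B.charpoly := by
  have hB : B = Q * A * Q := by rw [h, Matrix.mul_assoc, hQ, Matrix.mul_one]
  rw [hB, Matrix.charpoly_mul_comm, ← Matrix.mul_assoc, hQ, Matrix.one_mul]

theorem SimpleGraph.adjMatrix_compl_eq_sub {V R : Type*} [DecidableEq V] [Ring R]
    (G : SimpleGraph V) [DecidableRel G.Adj] [DecidableRel Gᶜ.Adj] :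
    Gᶜ.adjMatrix R = Matrix.of (fun _ _ => 1) - 1 - G.adjMatrix R := by
  ext x y
  by_cases hxy : x = y
  · subst hxy
    simp
  · by_cases h : G.Adj x y <;> simp [hxy, h]

/-- **Godsil–McKay switching.**  Let `G` be a graph and `{X_1, …, X_ℓ, Y}` a partition of
its vertex set such that (a) every `x ∈ Y` has `0`, `|X_i|/2` or `|X_i|` neighbors in
each `X_i`, and (b) for all `i, j` the number of neighbors in `X_j` of a vertex of `X_i`
depends only on `i` and `j`.  Let `G'` be obtained from `G` by, for each `x ∈ Y` and
each `i` with `x` having exactly `|X_i|/2` neighbors in `X_i`, deleting those edges and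
joining `x` instead to the other `|X_i|/2` vertices of `X_i`.  Then `G` and `G'` are
cospectral with respect to the adjacency matrix, and so are their complements. -/
theorem godsil_mckay_switching {V : Type*} [Fintype V] [DecidableEq V]
    (G G' : SimpleGraph V) {ℓ : ℕ} (X : Fin ℓ → Finset V) (Y : Finset V)
    -- `{X_1, …, X_ℓ, Y}` is a partition of the vertex set of `G`
    (hXX : ∀ i j, i ≠ j → Disjoint (X i) (X j))
    (hXY : ∀ i, Disjoint (X i) Y)
    (hcover : ∀ v, v ∈ Y ∨ ∃ i, v ∈ X i)
    -- (a) every `x ∈ Y` has `0`, `|X_i|/2` or `|X_i|` neighbors in `X_i`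
    (hhalf : ∀ x ∈ Y, ∀ i,
      ((X i).filter (fun y => G.Adj x y)).card = 0 ∨
      2 * ((X i).filter (fun y => G.Adj x y)).card = (X i).card ∨
      ((X i).filter (fun y => G.Adj x y)).card = (X i).card)
    -- (b) the number of neighbors in `X j` of a vertex of `X i` depends only on `i, j`
    (hreg : ∀ i j, ∀ x ∈ X i, ∀ y ∈ X i,
      ((X j).filter (fun z => G.Adj x z)).card =
        ((X j).filter (fun z => G.Adj y z)).card)
    -- `G'` is obtained from `G` by Godsil–McKay switching:
    (hYY : ∀ x ∈ Y, ∀ y ∈ Y, (G'.Adj x y ↔ G.Adj x y))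
    (hXadj : ∀ i j, ∀ x ∈ X i, ∀ y ∈ X j, (G'.Adj x y ↔ G.Adj x y))
    (hflip : ∀ x ∈ Y, ∀ i,
      2 * ((X i).filter (fun y => G.Adj x y)).card = (X i).card →
      ∀ y ∈ X i, (G'.Adj x y ↔ ¬ G.Adj x y))
    (hkeep : ∀ x ∈ Y, ∀ i,
      2 * ((X i).filter (fun y => G.Adj x y)).card ≠ (X i).card →
      ∀ y ∈ X i, (G'.Adj x y ↔ G.Adj x y)) :
    (G.adjMatrix ℝ).charpoly = (G'.adjMatrix ℝ).charpoly ∧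
    (Gᶜ.adjMatrix ℝ).charpoly = (G'ᶜ.adjMatrix ℝ).charpoly := by
  have hrow : ∀ x i, ∑ y ∈ X i, G.adjMatrix ℝ x y =
      (((X i).filter (fun y => G.Adj x y)).card : ℝ) := fun x i => by
    simp [SimpleGraph.adjMatrix_apply]
  have hQ := switchingMatrix_mul_self hXX hXY hcover
  have key : switchingMatrix X Y * G.adjMatrix ℝ = G'.adjMatrix ℝ * switchingMatrix X Y := by
    refine switchingMatrix_mul_eq_mul_switchingMatrix hXX hXY hcover
      (G.isSymm_adjMatrix) (G'.isSymm_adjMatrix) ?_ ?_ ?_ ?_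
    · intro i j x hx y hy
      rw [hrow, hrow, hreg i j x hx y hy]
    · intro x hx y hy
      simp only [SimpleGraph.adjMatrix_apply, hYY x hx y hy]
    · intro i j x hx y hy
      simp only [SimpleGraph.adjMatrix_apply, hXadj i j x hx y hy]
    · intro x hx i y hy
      have hc : (X i).card ≠ 0 := Finset.card_ne_zero_of_mem hy
      have hc' : ((X i).card : ℝ) ≠ 0 := by exact_mod_cast hc
      rw [hrow]
      simp only [SimpleGraph.adjMatrix_apply]
      obtain h | h | h := hhalf x hx i
      · have hxy : ¬ G.Adj x y := Finset.filter_eq_empty_iff.1 (Finset.card_eq_zero.1 h) hy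
        simp [hkeep x hx i (by omega) y hy, hxy, h]
      · have h' : 2 * (((X i).filter (fun y => G.Adj x y)).card : ℝ) = (X i).card := by
          exact_mod_cast h
        rw [div_mul_eq_mul_div, h', div_self hc']
        by_cases hxy : G.Adj x y <;> simp [hflip x hx i h y hy, hxy]
      · have hxy : G.Adj x y := Finset.card_filter_eq_iff.1 h y hy
        simp only [hkeep x hx i (by omega) y hy, hxy, h, if_true]
        field_simp
        norm_num
  refine ⟨Matrix.charpoly_eq_of_involution_intertwines hQ key,
    Matrix.charpoly_eq_of_involution_intertwines hQ ?_⟩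
  rw [SimpleGraph.adjMatrix_compl_eq_sub, SimpleGraph.adjMatrix_compl_eq_sub, Matrix.mul_sub,
    Matrix.mul_sub, Matrix.sub_mul, Matrix.sub_mul, key,
    switchingMatrix_mul_of_one hXX hXY hcover, of_one_mul_switchingMatrix hXX hXY hcover,
    Matrix.mul_one, Matrix.one_mul]
end

section
/- Let G_1 and G_2 be two graphs of the same order n that are cospectral with respect to the adjacency matrix, such that Z_-(G_1) ≠ Z_-(G_2) and Z_-(G_i) = M_-(G_i) for i = 1, 2. Then there exist infinitely many pairs of non-isomorphic graphs that are cospectral with respect to the adjacency matrix and have different zero forcing numbers and different skew zero forcing numbers. -/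
open SimpleGraph Matrix
open scoped Classical


/-- In the standard zero forcing process, a blue vertex `u` (in `B`) forces its unique
white neighbor `v`. -/
def StdForce {V : Type*} (G : SimpleGraph V) (B : Set V) (u v : V) : Prop :=
  u ∈ B ∧ v ∉ B ∧ G.Adj u v ∧ ∀ w, G.Adj u w → w ∉ B → w = v

/-- A set of blue vertices is closed (stalled) when no standard force is possible. -/
def ZFClosed {V : Type*} (G : SimpleGraph V) (B : Set V) : Prop :=
  ∀ u v, StdForce G B u v → v ∈ B

/-- `S` is a zero forcing set: iterating the color change rule from `S` colors every
vertex blue; equivalently, the only stalled superset of `S` is the whole vertex set. -/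
def IsZeroForcingSet {V : Type*} (G : SimpleGraph V) (S : Set V) : Prop :=
  ∀ B : Set V, S ⊆ B → ZFClosed G B → B = Set.univ

/-- The zero forcing number `Z(G)`. -/
noncomputable def zfNum {V : Type*} (G : SimpleGraph V) [Fintype V] : ℕ :=
  sInf {n | ∃ S : Finset V, IsZeroForcingSet G ↑S ∧ S.card = n}

/-- In the skew zero forcing process, any vertex `u` (blue or white) forces its unique
white neighbor `v`. -/
def SkewForce {V : Type*} (G : SimpleGraph V) (B : Set V) (u v : V) : Prop :=
  v ∉ B ∧ G.Adj u v ∧ ∀ w, G.Adj u w → w ∉ B → w = v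

/-- A set of blue vertices is closed (stalled) when no skew force is possible. -/
def SkewZFClosed {V : Type*} (G : SimpleGraph V) (B : Set V) : Prop :=
  ∀ u v, SkewForce G B u v → v ∈ B

/-- `S` is a skew zero forcing set: iterating the skew color change rule from `S` colors
every vertex blue. -/
def IsSkewZeroForcingSet {V : Type*} (G : SimpleGraph V) (S : Set V) : Prop :=
  ∀ B : Set V, S ⊆ B → SkewZFClosed G B → B = Set.univ

/-- The skew zero forcing number `Z₋(G)`. -/
noncomputable def skewZfNum {V : Type*} (G : SimpleGraph V) [Fintype V] : ℕ :=
  sInf {n | ∃ S : Finset V, IsSkewZeroForcingSet G ↑S ∧ S.card = n}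

/-- The maximum skew nullity `M₋(G)`: the largest nullity of a real skew-symmetric matrix
whose off-diagonal nonzero pattern is given by the adjacency of `G`. -/
noncomputable def skewMaxNullity {V : Type*} (G : SimpleGraph V) [Fintype V] : ℕ :=
  sSup {n | ∃ A : Matrix V V ℝ, Aᵀ = -A ∧
    (∀ i j, i ≠ j → (A i j ≠ 0 ↔ G.Adj i j)) ∧ n = Fintype.card V - A.rank}

theorem IsZeroForcingSet.isSkewZeroForcingSet {V : Type*} {G : SimpleGraph V} {S : Set V}
    (hS : IsZeroForcingSet G S) : IsSkewZeroForcingSet G S :=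
  fun B hSB hB => hS B hSB fun u v h => hB u v h.2

theorem isSkewZeroForcingSet_univ {V : Type*} (G : SimpleGraph V) :
    IsSkewZeroForcingSet G Set.univ :=
  fun _ hB _ => Set.univ_subset_iff.mp hB

theorem IsSkewZeroForcingSet.image_iso {V W : Type*} {G : SimpleGraph V} {H : SimpleGraph W}
    (φ : G ≃g H) {S : Set V} (hS : IsSkewZeroForcingSet G S) :
    IsSkewZeroForcingSet H (φ '' S) := by
  intro B hSB hB
  have key : φ ⁻¹' B = Set.univ := by
    refine hS _ (Set.image_subset_iff.mp hSB) fun u v ⟨hv, huv, h⟩ => ?_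
    refine hB (φ u) (φ v) ⟨hv, φ.map_adj_iff.mpr huv, fun w hw hwB => ?_⟩
    obtain ⟨w, rfl⟩ := φ.surjective w
    rw [h w (φ.map_adj_iff.mp hw) hwB]
  ext w
  obtain ⟨v, rfl⟩ := φ.surjective w
  simpa using Set.eq_univ_iff_forall.mp key v

theorem exists_isSkewZeroForcingSet_card_eq {V : Type*} [Fintype V] (G : SimpleGraph V) :
    ∃ S : Finset V, IsSkewZeroForcingSet G ↑S ∧ S.card = skewZfNum G :=
  Nat.sInf_mem (s := {n | ∃ S : Finset V, IsSkewZeroForcingSet G ↑S ∧ S.card = n})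
    ⟨_, Finset.univ, by simpa using isSkewZeroForcingSet_univ G, rfl⟩

theorem skewZfNum_le_of_iso {V W : Type*} [Fintype V] [Fintype W] {G : SimpleGraph V}
    {H : SimpleGraph W} (φ : G ≃g H) : skewZfNum H ≤ skewZfNum G := by
  obtain ⟨S, hS, hcard⟩ := exists_isSkewZeroForcingSet_card_eq G
  refine Nat.sInf_le ⟨S.map φ.toEquiv.toEmbedding, ?_, by simpa using hcard⟩
  rw [Finset.coe_map]
  exact hS.image_iso φ

theorem skewZfNum_eq_of_iso {V W : Type*} [Fintype V] [Fintype W] {G : SimpleGraph V}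
    {H : SimpleGraph W} (φ : G ≃g H) : skewZfNum G = skewZfNum H :=
  le_antisymm (skewZfNum_le_of_iso φ.symm) (skewZfNum_le_of_iso φ)

section Comap

variable {V W : Type*} {G : SimpleGraph V} {f : W → V}

/-- Two vertices in the same fibre are twins, so a skew zero forcing set misses at most one. -/
theorem IsSkewZeroForcingSet.injOn_compl {S : Set W}
    (hS : IsSkewZeroForcingSet (G.comap f) S) : Set.InjOn f Sᶜ := by
  intro x hx y hy hxy
  by_contra hne
  have key : ({x, y}ᶜ : Set W) = Set.univ := by
    refine hS _ (fun z hz => ?_) fun u v ⟨hv, huv, h⟩ => ?_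
    · rintro (rfl | rfl)
      exacts [hx hz, hy hz]
    · refine absurd ?_ hne
      have hadj : G.Adj (f u) (f v) := huv
      have hv' : f v = f x ∧ f v = f y := by
        rcases not_not.mp hv with rfl | rfl
        exacts [⟨rfl, hxy⟩, ⟨hxy.symm, rfl⟩]
      rw [h x (by simpa [← hv'.1] using hadj) (by simp),
        h y (by simpa [← hv'.2] using hadj) (by simp)]
  exact Set.eq_univ_iff_forall.mp key x (Or.inl rfl)

theorem IsSkewZeroForcingSet.compl_image_compl {S : Set W}
    (hS : IsSkewZeroForcingSet (G.comap f) S) : IsSkewZeroForcingSet G (f '' Sᶜ)ᶜ := by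
  intro C hTC hC
  have mem_image {w : V} (hw : w ∉ C) : w ∈ f '' Sᶜ := by
    by_contra h
    exact hw (hTC h)
  have key : S ∪ f ⁻¹' C = Set.univ := by
    refine hS _ Set.subset_union_left fun u v ⟨hv, huv, h⟩ => Or.inr ?_
    refine hC (f u) (f v) ⟨fun hvC => hv (Or.inr hvC), huv, fun w hw hwC => ?_⟩
    obtain ⟨x, hx, rfl⟩ := mem_image hwC
    rw [h x hw (by rintro (h | h); exacts [hx h, hwC h])]
  refine Set.eq_univ_iff_forall.mpr fun w => ?_
  by_contra hw
  obtain ⟨x, hx, rfl⟩ := mem_image hw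
  rcases Set.eq_univ_iff_forall.mp key x with h | h
  exacts [hx h, hw h]

/-- When every fibre has at least two elements, each contains a blue vertex, so every skew force
in `G` lifts to a standard force. -/
theorem isZeroForcingSet_comap {S : Set W} (hf : ∀ v, (f ⁻¹' {v}).Nontrivial)
    (hinj : Set.InjOn f Sᶜ) (hS : IsSkewZeroForcingSet G (f '' Sᶜ)ᶜ) :
    IsZeroForcingSet (G.comap f) S := by
  intro B hSB hB
  have key : (f '' Bᶜ)ᶜ = Set.univ := by
    refine hS _ (Set.compl_subset_compl.mpr (Set.image_mono (Set.compl_subset_compl.mpr hSB)))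
      fun u v ⟨hv, huv, h⟩ => ?_
    obtain ⟨x, hx, rfl⟩ := not_not.mp hv
    obtain ⟨b, hbS, rfl⟩ : ∃ b ∈ S, f b = u := by
      by_contra! hcon
      obtain ⟨a, ha, b, hb, hab⟩ := hf u
      exact hab (hinj (fun h => hcon a h ha) (fun h => hcon b h hb) (ha.trans hb.symm))
    refine absurd (hB b x ⟨hSB hbS, hx, huv, fun w hw hwB => ?_⟩) hx
    exact hinj (fun h => hwB (hSB h)) (fun h => hx (hSB h))
      (h (f w) hw (not_not.mpr ⟨w, hwB, rfl⟩))
  refine Set.eq_univ_iff_forall.mpr fun x => ?_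
  by_contra hx
  exact Set.eq_univ_iff_forall.mp key (f x) ⟨x, hx, rfl⟩

variable [Fintype V] [Fintype W]

theorem card_add_skewZfNum_le {S : Finset W} (hS : IsSkewZeroForcingSet (G.comap f) ↑S) :
    Fintype.card W + skewZfNum G ≤ Fintype.card V + S.card := by
  have hT := hS.compl_image_compl
  have hcard : (Sᶜ.image f).card = Sᶜ.card :=
    Finset.card_image_of_injOn (by simpa using hS.injOn_compl)
  have hle : skewZfNum G ≤ (Sᶜ.image f)ᶜ.card := Nat.sInf_le ⟨_, by simpa using hT, rfl⟩
  have h₁ := Finset.card_compl_add_card (Sᶜ.image f)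
  have h₂ := Finset.card_compl_add_card S
  omega

theorem exists_isZeroForcingSet_comap_card (G : SimpleGraph V)
    (hf : ∀ v, (f ⁻¹' {v}).Nontrivial) :
    ∃ S : Finset W, IsZeroForcingSet (G.comap f) ↑S ∧
      Fintype.card V + S.card = Fintype.card W + skewZfNum G := by
  obtain ⟨T, hT, hcard⟩ := exists_isSkewZeroForcingSet_card_eq G
  choose g hg using fun v => (hf v).nonempty
  have hfg (v : V) : f (g v) = v := hg v
  have hginj : Function.Injective g := Function.LeftInverse.injective hfg
  refine ⟨(Tᶜ.image g)ᶜ, isZeroForcingSet_comap hf ?_ ?_, ?_⟩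
  · simp only [Finset.coe_compl, Finset.coe_image, compl_compl]
    rintro _ ⟨a, -, rfl⟩ _ ⟨b, -, rfl⟩ h
    rw [hfg, hfg] at h
    rw [h]
  · simpa [Set.image_image, hfg] using hT
  · have h₁ := Finset.card_compl_add_card (Tᶜ.image g)
    have h₂ := Finset.card_compl_add_card T
    rw [Finset.card_image_of_injective _ hginj] at h₁
    omega

theorem card_add_skewZfNum_comap (G : SimpleGraph V) (hf : ∀ v, (f ⁻¹' {v}).Nontrivial) :
    Fintype.card V + skewZfNum (G.comap f) = Fintype.card W + skewZfNum G := by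
  obtain ⟨S, hS, hcard⟩ := exists_isSkewZeroForcingSet_card_eq (G.comap f)
  obtain ⟨S', hS', hcard'⟩ := exists_isZeroForcingSet_comap_card G hf
  have h₁ := card_add_skewZfNum_le hS
  have h₂ : skewZfNum (G.comap f) ≤ S'.card := Nat.sInf_le ⟨S', hS'.isSkewZeroForcingSet, rfl⟩
  omega

theorem zfNum_comap_eq_skewZfNum_comap (G : SimpleGraph V)
    (hf : ∀ v, (f ⁻¹' {v}).Nontrivial) : zfNum (G.comap f) = skewZfNum (G.comap f) := by
  obtain ⟨S', hS', hcard'⟩ := exists_isZeroForcingSet_comap_card G hf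
  have hskew := card_add_skewZfNum_comap G hf
  refine le_antisymm (Nat.sInf_le ⟨S', hS', by omega⟩) ?_
  obtain ⟨S, hS, hcard⟩ :=
    Nat.sInf_mem (s := {n | ∃ S : Finset W, IsZeroForcingSet (G.comap f) ↑S ∧ S.card = n})
      ⟨_, S', hS', rfl⟩
  exact Nat.sInf_le ⟨S, hS.isSkewZeroForcingSet, hcard⟩

end Comap

theorem Matrix.IsHermitian.charpoly_kronecker {ι κ : Type*} [Fintype ι] [DecidableEq ι]
    [Fintype κ] [DecidableEq κ] {A : Matrix ι ι ℝ} (hA : A.IsHermitian) (M : Matrix κ κ ℝ) :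
    (kroneckerMap (· * ·) A M).charpoly =
      (kroneckerMap (· * ·) (diagonal hA.eigenvalues) M).charpoly := by
  set U : Matrix ι ι ℝ := hA.eigenvectorUnitary.val
  have hU : star U * U = 1 := Unitary.coe_star_mul_self hA.eigenvectorUnitary
  have hA' : A = U * (diagonal hA.eigenvalues * star U) := by
    conv_lhs => rw [hA.spectral_theorem, Unitary.conjStarAlgAut_apply, mul_assoc]
    rfl
  have hkron : kroneckerMap (· * ·) A M =
      kroneckerMap (· * ·) U (1 : Matrix κ κ ℝ) *
        kroneckerMap (· * ·) (diagonal hA.eigenvalues * star U) M := by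
    rw [← mul_kronecker_mul, ← hA', one_mul]
  rw [hkron, charpoly_mul_comm, ← mul_kronecker_mul, mul_assoc, hU, mul_one, mul_one]

theorem charpoly_adjMatrix_comap_fst {n t : ℕ} (G₁ G₂ : SimpleGraph (Fin n))
    (h : (G₁.adjMatrix ℝ).charpoly = (G₂.adjMatrix ℝ).charpoly) :
    ((G₁.comap fun x : Fin (n * t) => (finProdFinEquiv.symm x).1).adjMatrix ℝ).charpoly =
      ((G₂.comap fun x : Fin (n * t) => (finProdFinEquiv.symm x).1).adjMatrix ℝ).charpoly := by
  have hcomap (G : SimpleGraph (Fin n)) :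
      (G.comap fun x : Fin (n * t) => (finProdFinEquiv.symm x).1).adjMatrix ℝ =
        reindex finProdFinEquiv finProdFinEquiv
          (kroneckerMap (· * ·) (G.adjMatrix ℝ) (of fun _ _ : Fin t => (1 : ℝ))) := by
    ext x y
    simp [adjMatrix_apply]
  have h₁ := isHermitian_adjMatrix ℝ G₁
  have h₂ := isHermitian_adjMatrix ℝ G₂
  rw [hcomap, hcomap, charpoly_reindex, charpoly_reindex, h₁.charpoly_kronecker,
    h₂.charpoly_kronecker, (h₁.eigenvalues_eq_eigenvalues_iff h₂).mpr h]

/-- If `G₁, G₂` are adjacency-cospectral graphs of the same order with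
`Z₋(G₁) ≠ Z₋(G₂)` and `Z₋(G_i) = M₋(G_i)`, then there are infinitely many pairs of
non-isomorphic adjacency-cospectral graphs with different zero forcing numbers and
different skew zero forcing numbers. -/
theorem infinitely_many_cospectral_pairs_different_zf {n : ℕ}
    (G₁ G₂ : SimpleGraph (Fin n))
    (hcospec : (G₁.adjMatrix ℝ).charpoly = (G₂.adjMatrix ℝ).charpoly)
    (hne : skewZfNum G₁ ≠ skewZfNum G₂)
    (h₁ : skewZfNum G₁ = skewMaxNullity G₁)
    (h₂ : skewZfNum G₂ = skewMaxNullity G₂) :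
    ∀ N : ℕ, ∃ m : ℕ, N ≤ m ∧ ∃ H₁ H₂ : SimpleGraph (Fin m),
      (H₁.adjMatrix ℝ).charpoly = (H₂.adjMatrix ℝ).charpoly ∧
      ¬ Nonempty (H₁ ≃g H₂) ∧
      zfNum H₁ ≠ zfNum H₂ ∧
      skewZfNum H₁ ≠ skewZfNum H₂ := by
  intro N
  have hn : 0 < n := by
    rcases Nat.eq_zero_or_pos n with rfl | hn
    · exact absurd (by rw [Subsingleton.elim G₁ G₂]) hne
    · exact hn
  let f : Fin (n * (N + 2)) → Fin n := fun x => (finProdFinEquiv.symm x).1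
  have hf (v : Fin n) : (f ⁻¹' {v}).Nontrivial :=
    ⟨finProdFinEquiv (v, 0), congrArg Prod.fst (finProdFinEquiv.symm_apply_apply _),
      finProdFinEquiv (v, 1), congrArg Prod.fst (finProdFinEquiv.symm_apply_apply _), by simp⟩
  have hskew : skewZfNum (G₁.comap f) ≠ skewZfNum (G₂.comap f) := by
    have h₁ := card_add_skewZfNum_comap G₁ hf
    have h₂ := card_add_skewZfNum_comap G₂ hf
    omega
  refine ⟨n * (N + 2), by nlinarith, G₁.comap f, G₂.comap f,
    charpoly_adjMatrix_comap_fst G₁ G₂ hcospec, ?_, ?_, hskew⟩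
  · rintro ⟨φ⟩
    exact hskew (skewZfNum_eq_of_iso φ)
  · rwa [zfNum_comap_eq_skewZfNum_comap G₁ hf, zfNum_comap_eq_skewZfNum_comap G₂ hf]
end

section
/- For every integer r ≥ 2, the Cartesian product K_r □ K_r of two complete graphs on r vertices satisfies Z_+(K_r □ K_r) = M_+(K_r □ K_r) = (r-1)^2 + 1. -/
open SimpleGraph Matrix

/-- In the positive semidefinite zero forcing process, a blue vertex `u` forces its white
neighbor `v` when no other white neighbor of `u` is joined to `v` by a path of white
vertices. -/
def PsdForce {V : Type*} (G : SimpleGraph V) (B : Set V) (u v : V) : Prop :=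
  u ∈ B ∧ G.Adj u v ∧ ∃ hv : v ∉ B,
    ∀ w, G.Adj u w → ∀ hw : w ∉ B, w ≠ v →
      ¬ (G.induce Bᶜ).Reachable ⟨w, hw⟩ ⟨v, hv⟩

/-- A set of blue vertices is closed (stalled) when no positive semidefinite force is
possible. -/
def PsdZFClosed {V : Type*} (G : SimpleGraph V) (B : Set V) : Prop :=
  ∀ u v, PsdForce G B u v → v ∈ B

/-- `S` is a positive semidefinite zero forcing set: iterating the positive semidefinite
color change rule from `S` colors every vertex blue. -/
def IsPsdZeroForcingSet {V : Type*} (G : SimpleGraph V) (S : Set V) : Prop :=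
  ∀ B : Set V, S ⊆ B → PsdZFClosed G B → B = Set.univ

/-- The positive semidefinite zero forcing number `Z₊(G)`. -/
noncomputable def psdZfNum {V : Type*} (G : SimpleGraph V) [Fintype V] : ℕ :=
  sInf {n | ∃ S : Finset V, IsPsdZeroForcingSet G ↑S ∧ S.card = n}

/-- The maximum positive semidefinite nullity `M₊(G)`: the largest nullity of a real
positive semidefinite symmetric matrix whose off-diagonal nonzero pattern is given by the
adjacency of `G`. -/
noncomputable def psdMaxNullity {V : Type*} (G : SimpleGraph V) [Fintype V] : ℕ :=
  sSup {n | ∃ A : Matrix V V ℝ, A.PosSemidef ∧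
    (∀ i j, i ≠ j → (A i j ≠ 0 ↔ G.Adj i j)) ∧ n = Fintype.card V - A.rank}

/-- A kernel vector of a positive semidefinite matrix with graph `G` vanishes as soon as it
vanishes on a positive semidefinite zero forcing set. -/
theorem eq_zero_of_isPsdZeroForcingSet {V : Type*} [Fintype V] {G : SimpleGraph V} {S : Set V}
    (hS : IsPsdZeroForcingSet G S) {A : Matrix V V ℝ} (hA : A.PosSemidef)
    (hG : ∀ i j, i ≠ j → (A i j ≠ 0 ↔ G.Adj i j)) {x : V → ℝ} (hx : A *ᵥ x = 0)
    (hxS : ∀ v ∈ S, x v = 0) : x = 0 := by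
  classical
  have key : {v | x v = 0} = Set.univ := by
    refine hS _ hxS ?_
    rintro u v ⟨hu, huv, hv, huniq⟩
    set B : Set V := {v | x v = 0} with hB
    let C : Set V := {w | ∃ hw : w ∉ B, (G.induce Bᶜ).Reachable ⟨w, hw⟩ ⟨v, hv⟩}
    let y : V → ℝ := fun w => if w ∈ C then x w else 0
    have hyx : y ⬝ᵥ (A *ᵥ (x - y)) = 0 := by
      simp only [dotProduct, mulVec, Finset.mul_sum]
      refine Finset.sum_eq_zero fun i _ => Finset.sum_eq_zero fun j _ => ?_
      by_cases hi : i ∈ C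
      swap
      · simp [y, hi]
      by_cases hj : j ∈ C
      · simp [y, hj]
      by_cases hjB : j ∈ B
      · have : x j = 0 := hjB
        simp [y, hj, this]
      have hij : i ≠ j := by rintro rfl; exact hj hi
      have hadj : ¬ G.Adj i j := by
        intro hadj
        obtain ⟨hiB, hreach⟩ := hi
        refine hj ⟨hjB, SimpleGraph.Reachable.trans (SimpleGraph.Adj.reachable ?_) hreach⟩
        exact hadj.symm
      have : A i j = 0 := by
        by_contra h
        exact hadj ((hG i j hij).1 h)
      simp [this]
    have hyy : y ⬝ᵥ (A *ᵥ y) = 0 := by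
      rw [mulVec_sub, dotProduct_sub, hx, dotProduct_zero, zero_sub, neg_eq_zero] at hyx
      exact hyx
    have hAy : A *ᵥ y = 0 := (hA.dotProduct_mulVec_zero_iff y).1 (by simpa using hyy)
    have huC : u ∉ C := fun h => h.1 hu
    have hvC : v ∈ C := ⟨hv, SimpleGraph.Reachable.refl _⟩
    have hsum : (A *ᵥ y) u = A u v * x v := by
      simp only [mulVec, dotProduct]
      rw [Finset.sum_eq_single v]
      · simp [y, hvC]
      · intro w _ hwv
        by_cases hw : w ∈ C
        · have huw : u ≠ w := by rintro rfl; exact huC hw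
          have : A u w = 0 := by
            by_contra h
            exact huniq w ((hG u w huw).1 h) hw.1 hwv hw.2
          simp [this]
        · simp [y, hw]
      · simp
    rw [hAy] at hsum
    have hne : A u v ≠ 0 := (hG u v huv.ne).2 huv
    exact (mul_eq_zero.1 hsum.symm).resolve_left hne
  funext v
  exact (Set.ext_iff.1 key v).2 trivial

/-- The nullity of a positive semidefinite matrix with graph `G` is at most the size of any
positive semidefinite zero forcing set of `G`. -/
theorem card_sub_rank_le_card_of_isPsdZeroForcingSet {V : Type*} [Fintype V]
    {G : SimpleGraph V} {S : Finset V} (hS : IsPsdZeroForcingSet G ↑S) {A : Matrix V V ℝ}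
    (hA : A.PosSemidef) (hG : ∀ i j, i ≠ j → (A i j ≠ 0 ↔ G.Adj i j)) :
    Fintype.card V - A.rank ≤ S.card := by
  have hker := A.mulVecLin.finrank_range_add_finrank_ker
  rw [Module.finrank_fintype_fun_eq_card] at hker
  let f : LinearMap.ker A.mulVecLin →ₗ[ℝ] (S → ℝ) :=
    (LinearMap.funLeft ℝ ℝ ((↑) : S → V)).comp (LinearMap.ker A.mulVecLin).subtype
  have hf : Function.Injective f := by
    rw [← LinearMap.ker_eq_bot, LinearMap.ker_eq_bot']
    rintro ⟨x, hx⟩ hfx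
    refine Subtype.ext (eq_zero_of_isPsdZeroForcingSet hS hA hG hx fun v hv => ?_)
    exact congrFun hfx ⟨v, hv⟩
  have hle := LinearMap.finrank_le_finrank_of_injective hf
  rw [Module.finrank_fintype_fun_eq_card, Fintype.card_coe] at hle
  rw [Matrix.rank]
  omega

/-- A positive semidefinite zero forcing set and a positive semidefinite matrix whose size and
nullity match certify the values of both parameters. -/
theorem psdZfNum_psdMaxNullity_eq_of_card_add_rank_le {V : Type*} [Fintype V]
    {G : SimpleGraph V} {S : Finset V} (hS : IsPsdZeroForcingSet G ↑S) {A : Matrix V V ℝ}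
    (hA : A.PosSemidef) (hG : ∀ i j, i ≠ j → (A i j ≠ 0 ↔ G.Adj i j))
    (hcard : S.card + A.rank ≤ Fintype.card V) :
    psdZfNum G = S.card ∧ psdMaxNullity G = S.card := by
  constructor
  · apply le_antisymm
    · exact Nat.sInf_le ⟨S, hS, rfl⟩
    · refine le_csInf ⟨_, S, hS, rfl⟩ ?_
      rintro _ ⟨T, hT, rfl⟩
      have := card_sub_rank_le_card_of_isPsdZeroForcingSet hT hA hG
      omega
  · have hub : ∀ n ∈ {n | ∃ A : Matrix V V ℝ, A.PosSemidef ∧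
        (∀ i j, i ≠ j → (A i j ≠ 0 ↔ G.Adj i j)) ∧ n = Fintype.card V - A.rank},
        n ≤ S.card := by
      rintro _ ⟨A', hA', hG', rfl⟩
      exact card_sub_rank_le_card_of_isPsdZeroForcingSet hS hA' hG'
    apply le_antisymm
    · exact csSup_le ⟨_, A, hA, hG, rfl⟩ hub
    · exact (Nat.le_sub_of_add_le hcard).trans (le_csSup ⟨_, hub⟩ ⟨A, hA, hG, rfl⟩)

/-- The vertices of `K_{m+1} □ K_{m+1}` that lie neither in row `0` nor in column `0`, together
with the corner `(0, 0)`. -/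
def rookZeroForcingSet (m : ℕ) : Finset (Fin (m + 1) × Fin (m + 1)) :=
  insert (0, 0) (Finset.univ.map ((Fin.succEmb m).prodMap (Fin.succEmb m)))

theorem card_rookZeroForcingSet (m : ℕ) : (rookZeroForcingSet m).card = m ^ 2 + 1 := by
  rw [rookZeroForcingSet, Finset.card_insert_of_notMem, Finset.card_map]
  · simp [sq]
  · simp [Fin.succ_ne_zero]

theorem isPsdZeroForcingSet_rookZeroForcingSet (m : ℕ) :
    IsPsdZeroForcingSet ((⊤ : SimpleGraph (Fin (m + 1))) □ (⊤ : SimpleGraph (Fin (m + 1))))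
      ↑(rookZeroForcingSet m) := by
  intro B hB hclosed
  have h00 : ((0, 0) : Fin (m + 1) × Fin (m + 1)) ∈ B := hB (by simp [rookZeroForcingSet])
  have hss (i j : Fin m) : (i.succ, j.succ) ∈ B := hB (by simp [rookZeroForcingSet])
  have hwhite (w) (hw : w ∉ B) : w.1 = 0 ↔ w.2 ≠ 0 := by
    obtain ⟨i, j⟩ := w
    cases i using Fin.cases <;> cases j using Fin.cases <;> simp_all [Fin.succ_ne_zero]
  have hreach (w v : ↥Bᶜ)
      (h : (((⊤ : SimpleGraph (Fin (m + 1))) □ (⊤ : SimpleGraph (Fin (m + 1)))).induce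
        Bᶜ).Reachable w v) : w.1.1 = 0 ↔ v.1.1 = 0 := by
    obtain ⟨p⟩ := h
    induction p with
    | nil => rfl
    | @cons a b c hab _ ih =>
      rw [← ih]
      have ha := hwhite a a.2
      have hb := hwhite b b.2
      simp only [SimpleGraph.comap_adj, SimpleGraph.boxProd_adj, SimpleGraph.top_adj,
        Function.Embedding.subtype_apply] at hab
      grind
  have hrow (i j : Fin m) : ((0 : Fin (m + 1)), j.succ) ∈ B := by
    by_contra hv
    refine hv (hclosed (i.succ, j.succ) _ ⟨hss i j, ?_, hv, fun w huw hw hwv hr => ?_⟩)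
    · simp [SimpleGraph.boxProd_adj]
    · have h1 := (hreach _ _ hr).2 rfl
      simp only [SimpleGraph.boxProd_adj, SimpleGraph.top_adj] at huw
      obtain ⟨a, b⟩ := w
      grind
  have hcol (i j : Fin m) : (i.succ, (0 : Fin (m + 1))) ∈ B := by
    by_contra hv
    refine hv (hclosed (i.succ, j.succ) _ ⟨hss i j, ?_, hv, fun w huw hw hwv hr => ?_⟩)
    · simp [SimpleGraph.boxProd_adj]
    · have h1 := hreach _ _ hr
      have h2 := hwhite w hw
      simp only [SimpleGraph.boxProd_adj, SimpleGraph.top_adj] at huw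
      have := Fin.succ_ne_zero i
      obtain ⟨a, b⟩ := w
      grind
  ext ⟨i, j⟩
  cases i using Fin.cases with
  | zero => cases j using Fin.cases with
    | zero => simpa
    | succ j => simpa using hrow j j
  | succ i => cases j using Fin.cases with
    | zero => simpa using hcol i i
    | succ j => simpa using hss i j

/-- An orthogonal representation of `K_{m+1} □ K_{m+1}` in dimension `2 * m`. -/
def rookVec (m : ℕ) (p : Fin (m + 1) × Fin (m + 1)) : Fin m ⊕ Fin m → ℝ :=
  Fin.cases (motive := fun _ => Fin m ⊕ Fin m → ℝ)
    (Fin.cases (motive := fun _ => Fin m ⊕ Fin m → ℝ) (Sum.elim (1 : Fin m → ℝ) (-1))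
      (fun j => Sum.elim (1 : Fin m → ℝ) (-1) - Pi.single (Sum.inr j) 1) p.2)
    (fun i => Fin.cases (motive := fun _ => Fin m ⊕ Fin m → ℝ)
      (Sum.elim (1 : Fin m → ℝ) (-1) - Pi.single (Sum.inl i) (2 * m + 1 : ℝ))
      (fun j => Pi.single (Sum.inl i) 1 + Pi.single (Sum.inr j) 1) p.2) p.1

theorem rookVec_dotProduct_ne_zero_iff {m : ℕ} (hm : 1 ≤ m) {p q : Fin (m + 1) × Fin (m + 1)}
    (hpq : p ≠ q) : rookVec m p ⬝ᵥ rookVec m q ≠ 0 ↔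
      ((⊤ : SimpleGraph (Fin (m + 1))) □ (⊤ : SimpleGraph (Fin (m + 1)))).Adj p q := by
  have hm' : (1 : ℝ) ≤ m := by exact_mod_cast hm
  obtain ⟨i, j⟩ := p
  obtain ⟨k, l⟩ := q
  cases i using Fin.cases <;> cases j using Fin.cases <;> cases k using Fin.cases <;>
    cases l using Fin.cases <;>
    simp [rookVec, SimpleGraph.boxProd_adj, add_dotProduct, dotProduct_add, sub_dotProduct,
      dotProduct_sub, Pi.single_apply, Fin.succ_ne_zero, Fin.succ_inj,
      (Fin.succ_ne_zero _).symm] at hpq ⊢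
  all_goals try grind
  rw [if_neg (Ne.symm hpq), sub_zero, one_mul]
  exact iff_of_true (by linarith) hpq

/-- For every integer `r ≥ 2`,
`Z₊(K_r □ K_r) = M₊(K_r □ K_r) = (r-1)² + 1`. -/
theorem psdZfNum_boxProd_complete_complete (r : ℕ) (hr : 2 ≤ r) :
    psdZfNum ((⊤ : SimpleGraph (Fin r)) □ (⊤ : SimpleGraph (Fin r))) = (r - 1)^2 + 1 ∧
    psdMaxNullity ((⊤ : SimpleGraph (Fin r)) □ (⊤ : SimpleGraph (Fin r))) = (r - 1)^2 + 1 := by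
  obtain ⟨m, rfl⟩ : ∃ m, r = m + 1 := ⟨r - 1, by omega⟩
  let W : Matrix (Fin m ⊕ Fin m) (Fin (m + 1) × Fin (m + 1)) ℝ := .of fun t p => rookVec m p t
  have hrank : (Wᴴ * W).rank ≤ 2 * m := by
    rw [rank_conjTranspose_mul_self]
    refine W.rank_le_card_height.trans ?_
    simp [two_mul]
  rw [Nat.add_sub_cancel, ← card_rookZeroForcingSet]
  refine psdZfNum_psdMaxNullity_eq_of_card_add_rank_le (isPsdZeroForcingSet_rookZeroForcingSet m)
    (posSemidef_conjTranspose_mul_self W)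
    (fun p q hpq => rookVec_dotProduct_ne_zero_iff (by omega) hpq) ?_
  rw [card_rookZeroForcingSet, Fintype.card_prod, Fintype.card_fin]
  linarith
end

section
/- Let r ≥ 11 be an integer, let G_1 be the lattice graph L_2(4) = K_4 □ K_4 (the line graph of K_{4,4}), and let G_2 be the Shrikhande graph. Then Z_+(G_1 □ K_r) ≠ Z_+(G_2 □ K_r); in fact Z_+(G_2 □ K_r) < Z_+(G_1 □ K_r). -/
open SimpleGraph Matrix

/-- The lattice graph `L₂(4) = K₄ □ K₄`. -/
def latticeGraph44 : SimpleGraph (Fin 4 × Fin 4) :=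
  (⊤ : SimpleGraph (Fin 4)) □ (⊤ : SimpleGraph (Fin 4))

/-- The Shrikhande graph: the Cayley graph on `ℤ₄ × ℤ₄` with connection set
`{±(1,0), ±(0,1), ±(1,1)}`. -/
def shrikhandeGraph : SimpleGraph (ZMod 4 × ZMod 4) :=
  SimpleGraph.circulantGraph
    ({((1 : ZMod 4), (0 : ZMod 4)), (-1, 0), (0, 1), (0, -1), (1, 1), (-1, -1)} :
      Set (ZMod 4 × ZMod 4))

/-- A family of real vectors indexed by the vertices of `G` is an orthogonal representation when
distinct vertices are adjacent exactly if their vectors are not orthogonal. -/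
def IsOrthogonalRep {V κ : Type*} [Fintype κ] (G : SimpleGraph V) (p : V → κ → ℝ) : Prop :=
  ∀ u v, u ≠ v → (p u ⬝ᵥ p v ≠ 0 ↔ G.Adj u v)

/-- In an orthogonal representation, a linear relation that vanishes on a positive semidefinite
zero forcing set is trivial. -/
lemma IsPsdZeroForcingSet.eq_zero_of_sum_smul_eq_zero {V κ : Type*} [Fintype V] [Fintype κ]
    {G : SimpleGraph V} {S : Set V} (hS : IsPsdZeroForcingSet G S) {p : V → κ → ℝ}
    (hp : IsOrthogonalRep G p) {x : V → ℝ} (hx : ∑ v, x v • p v = 0) (hxS : ∀ v ∈ S, x v = 0) :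
    x = 0 := by
  classical
  have key : {v | x v = 0} = Set.univ := by
    refine hS _ hxS fun u v hf ↦ ?_
    obtain ⟨hu, huv, hv, hw⟩ := hf
    exfalso
    let C : Set V := {w | ∃ h : w ∉ {v | x v = 0},
      (G.induce {v | x v = 0}ᶜ).Reachable ⟨w, h⟩ ⟨v, hv⟩}
    let z : κ → ℝ := ∑ w, (if w ∈ C then x w else 0) • p w
    let z' : κ → ℝ := ∑ w, (if w ∈ C then 0 else x w) • p w
    have hzz : z + z' = 0 := by
      rw [← hx, ← Finset.sum_add_distrib]
      refine Finset.sum_congr rfl fun w _ ↦ ?_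
      split_ifs <;> simp
    have horth : z ⬝ᵥ z' = 0 := by
      simp only [z, z', sum_dotProduct, dotProduct_sum]
      refine Finset.sum_eq_zero fun b _ ↦ Finset.sum_eq_zero fun a _ ↦ ?_
      simp only [smul_dotProduct, dotProduct_smul, smul_eq_mul]
      by_cases ha : a ∈ C
      · by_cases hb : b ∈ C
        · simp [hb]
        · by_cases hxb : x b = 0
          · simp [hxb]
          · have hab : ¬ G.Adj a b := by
              intro hab
              obtain ⟨ha', har⟩ := ha
              refine hb ⟨hxb, Reachable.trans (Adj.reachable ?_) har⟩
              exact hab.symm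
            have : p a ⬝ᵥ p b = 0 := by
              by_contra h
              exact hab ((hp a b (fun h ↦ hb (h ▸ ha))).1 h)
            simp [this]
      · simp [ha]
    have hz : z = 0 := by
      rw [← dotProduct_self_eq_zero]
      have : z ⬝ᵥ (z + z') = 0 := by rw [hzz, dotProduct_zero]
      rwa [dotProduct_add, horth, add_zero] at this
    have hvC : v ∈ C := ⟨hv, Reachable.refl _⟩
    have huz : p u ⬝ᵥ z = x v * (p u ⬝ᵥ p v) := by
      simp only [z, dotProduct_sum, dotProduct_smul, smul_eq_mul]
      rw [Finset.sum_eq_single v]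
      · simp [hvC]
      · intro w _ hwv
        by_cases hwC : w ∈ C
        · obtain ⟨hw', hr⟩ := hwC
          have huw : u ≠ w := fun h ↦ hw' (h ▸ hu)
          have : p u ⬝ᵥ p w = 0 := by
            by_contra h
            exact hw w ((hp u w huw).1 h) hw' hwv hr
          simp [this]
        · simp [hwC]
      · simp
    rw [hz, dotProduct_zero] at huz
    rcases mul_eq_zero.1 huz.symm with h | h
    · exact hv h
    · exact (hp u v huv.ne).2 huv h
  ext v
  exact (key ▸ Set.mem_univ v : v ∈ {v | x v = 0})

/-- The vectors of an orthogonal representation at the complement of a positive semidefinite zero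
forcing set are linearly independent, which bounds the size of the complement. -/
lemma IsPsdZeroForcingSet.card_le {V κ : Type*} [Fintype V] [Fintype κ]
    {G : SimpleGraph V} {S : Finset V} (hS : IsPsdZeroForcingSet G (S : Set V)) {p : V → κ → ℝ}
    (hp : IsOrthogonalRep G p) (K : Submodule ℝ (κ → ℝ)) (hK : ∀ v, p v ∈ K) :
    Fintype.card V ≤ S.card + Module.finrank ℝ K := by
  classical
  have hli : LinearIndependent ℝ (fun v : {v // v ∉ S} ↦ (⟨p v, hK v⟩ : K)) := by
    rw [Fintype.linearIndependent_iff]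
    intro c hc i
    let x : V → ℝ := fun v ↦ if h : v ∉ S then c ⟨v, h⟩ else 0
    have hx : x = 0 := by
      refine hS.eq_zero_of_sum_smul_eq_zero hp ?_ fun v hv ↦ ?_
      · have h := congrArg K.subtype hc
        simp only [map_sum, map_smul, Submodule.subtype_apply, map_zero] at h
        rw [← h, ← Finset.sum_filter_add_sum_filter_not Finset.univ (· ∉ S),
          Finset.sum_subtype (p := (· ∉ S)) (Finset.univ.filter (· ∉ S)) (by simp),
          Finset.sum_eq_zero (s := Finset.univ.filter (¬ · ∉ S)) (by simp +contextual [x]),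
          add_zero]
        exact Finset.sum_congr rfl fun v _ ↦ by simp [x, v.2]
      · have : v ∈ S := hv
        simp [x, this]
    have := congrFun hx i
    simpa [x, i.2] using this
  have h := hli.fintype_card_le_finrank
  rw [Fintype.card_subtype_compl] at h
  simp only [Fintype.card_coe] at h
  omega

/-- If the vectors `p v` form an orthogonal representation of `G`, the vectors
`(p v ⊗ eᵢ, e_v)` form one of `G □ K_r`. -/
def prodTopRep {V κ : Type*} [DecidableEq V] (r : ℕ) (p : V → κ → ℝ) :
    V × Fin r → (Fin r × κ) ⊕ V → ℝ :=
  fun v ↦ Sum.elim (fun jk ↦ if v.2 = jk.1 then p v.1 jk.2 else 0) (Pi.single v.1 1)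

lemma IsOrthogonalRep.prodTopRep {V κ : Type*} [Fintype V] [DecidableEq V] [Fintype κ]
    {G : SimpleGraph V} {p : V → κ → ℝ} (hp : IsOrthogonalRep G p) (r : ℕ) :
    IsOrthogonalRep (G □ (⊤ : SimpleGraph (Fin r))) (prodTopRep r p) := by
  rintro ⟨g, i⟩ ⟨h, j⟩ hne
  have key : _root_.prodTopRep r p (g, i) ⬝ᵥ _root_.prodTopRep r p (h, j) =
      (if i = j then p g ⬝ᵥ p h else 0) + if g = h then 1 else 0 := by
    simp only [_root_.prodTopRep, dotProduct, Fintype.sum_sum_type, Sum.elim_inl, Sum.elim_inr,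
      Fintype.sum_prod_type]
    congr 1
    · by_cases hij : i = j
      · subst hij
        simp [Finset.sum_ite_irrel]
      · rw [if_neg hij]
        refine Finset.sum_eq_zero fun k _ ↦ Finset.sum_eq_zero fun l _ ↦ ?_
        grind
    · simp [Pi.single_apply, eq_comm]
  rw [key]
  by_cases hij : i = j
  · have hgh : g ≠ h := fun hgh ↦ hne (by rw [hgh, hij])
    simp [hij, hgh, boxProd_adj, hp g h hgh]
  · simp [hij, boxProd_adj]

/-- `Z₊(G □ K_r) ≥ (r - 1) (|V(G)| - d)` if `G` has an orthogonal representation in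
dimension `d`. -/
lemma IsPsdZeroForcingSet.card_ge_boxProd_top {V κ : Type*} [Fintype V] [Fintype κ]
    {G : SimpleGraph V} {p : V → κ → ℝ} (hp : IsOrthogonalRep G p) {n : ℕ}
    {S : Finset (V × Fin (n + 1))}
    (hS : IsPsdZeroForcingSet (G □ (⊤ : SimpleGraph (Fin (n + 1)))) (S : Set (V × Fin (n + 1)))) :
    n * Fintype.card V ≤ S.card + n * Fintype.card κ := by
  classical
  let Φ : ((Fin (n + 1) × κ) ⊕ V → ℝ) →ₗ[ℝ] (κ → ℝ) :=
    { toFun := fun w k ↦ ∑ i, w (.inl (i, k)) - ∑ v, w (.inr v) * p v k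
      map_add' := by
        intro w w'
        ext k
        simp only [Pi.add_apply, Finset.sum_add_distrib, add_mul]
        ring
      map_smul' := by
        intro c w
        ext k
        simp only [Pi.smul_apply, smul_eq_mul, mul_assoc, ← Finset.mul_sum, RingHom.id_apply]
        ring }
  have hΦ : Function.Surjective Φ := by
    intro y
    refine ⟨Sum.elim (fun ik ↦ if ik.1 = 0 then y ik.2 else 0) 0, ?_⟩
    ext k
    simp [Φ]
  have hmem (v) : prodTopRep (n + 1) p v ∈ LinearMap.ker Φ := by
    rw [LinearMap.mem_ker]
    ext k
    simp [Φ, prodTopRep, Pi.single_apply]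
  have h := hS.card_le (hp.prodTopRep _) _ hmem
  have hrank := LinearMap.finrank_range_add_finrank_ker Φ
  rw [LinearMap.range_eq_top.2 hΦ, finrank_top] at hrank
  simp only [Module.finrank_fintype_fun_eq_card, Fintype.card_sum, Fintype.card_prod,
    Fintype.card_fin] at hrank h
  nlinarith

/-- `Z₊(G) ≤ |S|` for every positive semidefinite zero forcing set `S`. -/
lemma IsPsdZeroForcingSet.psdZfNum_le {V : Type*} [Fintype V] {G : SimpleGraph V} {S : Finset V}
    (hS : IsPsdZeroForcingSet G (S : Set V)) : psdZfNum G ≤ S.card :=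
  Nat.sInf_le ⟨S, hS, rfl⟩

lemma exists_isPsdZeroForcingSet_card_eq {V : Type*} [Fintype V] (G : SimpleGraph V) :
    ∃ S : Finset V, IsPsdZeroForcingSet G (S : Set V) ∧ S.card = psdZfNum G :=
  Nat.sInf_mem (s := {n | ∃ S : Finset V, IsPsdZeroForcingSet G ↑S ∧ S.card = n})
    ⟨_, Finset.univ, fun B hB _ ↦ Set.univ_subset_iff.1 (by simpa using hB), rfl⟩

/-- Taking all copies of the vertices of a positive semidefinite zero forcing set of `G` yields
one of `G □ H`. -/
lemma IsPsdZeroForcingSet.boxProd {V W : Type*} {G : SimpleGraph V} {S : Set V}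
    (hS : IsPsdZeroForcingSet G S) (H : SimpleGraph W) :
    IsPsdZeroForcingSet (G □ H) (S ×ˢ Set.univ) := by
  intro B hSB hB
  let B' : Set V := {g | ∀ i, (g, i) ∈ B}
  suffices h : B' = Set.univ by
    ext ⟨g, i⟩
    exact iff_of_true ((h ▸ Set.mem_univ g : g ∈ B') i) (Set.mem_univ _)
  refine hS B' (fun g hg i ↦ hSB ⟨hg, Set.mem_univ _⟩) ?_
  rintro u v ⟨hu, huv, hv, hw⟩ i
  by_contra hvi
  refine hvi (hB (u, i) (v, i) ⟨hu i, boxProd_adj_left.2 huv, hvi, ?_⟩)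
  rintro ⟨w, j⟩ hadj hwj hne hreach
  rcases boxProd_adj.1 hadj with ⟨huw, hij⟩ | ⟨-, huw⟩
  · obtain rfl : i = j := hij
    have hproj (a b : ↥Bᶜ) (hab : ((G □ H).induce Bᶜ).Reachable a b) :
        (G.induce B'ᶜ).Reachable ⟨a.1.1, fun h ↦ a.2 (h _)⟩ ⟨b.1.1, fun h ↦ b.2 (h _)⟩ := by
      obtain ⟨q⟩ := hab
      induction q with
      | nil => exact Reachable.refl _
      | cons hadj _ ih =>
        refine Reachable.trans ?_ ih
        rcases boxProd_adj.1 hadj with ⟨h, -⟩ | ⟨-, h⟩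
        · exact Adj.reachable h
        · convert Reachable.refl _ using 1
          exact Subtype.ext h.symm
    exact hw w huw (fun h ↦ hwj (h _)) (fun h ↦ hne (by rw [h])) (hproj _ _ hreach)
  · obtain rfl : u = w := huw
    exact hwj (hu j)

/-- Among the vertices outside a set `P` of blue vertices, let `C` be a union of connected
components. A vertex of `P` whose only neighbor in `C` is `v` forces `v`. -/
lemma PsdZFClosed.mem_of_unique_adj {V : Type*} {G : SimpleGraph V} {B P C : Set V}
    (hB : PsdZFClosed G B) (hP : P ⊆ B) {u v : V} (hu : u ∈ P) (hv : v ∈ C) (huv : G.Adj u v)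
    (hC : ∀ a ∈ C, ∀ b, G.Adj a b → b ∈ P ∨ b ∈ C) (huC : ∀ w ∈ C, G.Adj u w → w = v) :
    v ∈ B := by
  by_contra hvB
  refine hvB (hB u v ⟨hP hu, huv, hvB, fun w huw hw hwv hr ↦ hwv (huC w ?_ huw)⟩)
  have hreach (a b : ↥Bᶜ) (hab : (G.induce Bᶜ).Reachable a b) (ha : a.1 ∈ C) : b.1 ∈ C := by
    obtain ⟨q⟩ := hab
    induction q with
    | nil => exact ha
    | @cons a b _ hadj _ ih => exact ih ((hC _ ha _ hadj).resolve_left fun h ↦ b.2 (hP h))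
  exact hreach _ _ hr.symm hv

/-- The vectors `(e_a, f_b)` where distinct `e_a` have inner product `1` and distinct `f_b` have
inner product `-1`. -/
noncomputable def latticeRep (v : Fin 4 × Fin 4) : Fin 3 ⊕ Fin 3 → ℝ :=
  Sum.elim (![![1, 1, 0], ![1, 0, 1], ![0, 1, 1], ![1 / 2, 1 / 2, 1 / 2]] v.1)
    (![![1, 1, 1], ![1, -1, -1], ![-1, 1, -1], ![-1, -1, 1]] v.2)

lemma isOrthogonalRep_latticeRep : IsOrthogonalRep latticeGraph44 latticeRep := by
  rintro ⟨a, b⟩ ⟨c, d⟩ hne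
  have key : latticeRep (a, b) ⬝ᵥ latticeRep (c, d) =
      (if a = c then if a = 3 then 3 / 4 else 2 else 1) + if b = d then 3 else -1 := by
    simp only [latticeRep, dotProduct, Fintype.sum_sum_type, Sum.elim_inl, Sum.elim_inr]
    congr 1
    · fin_cases a <;> fin_cases c <;> simp [Fin.sum_univ_three] <;> norm_num
    · fin_cases b <;> fin_cases d <;> simp [Fin.sum_univ_three] <;> norm_num
  rw [key, latticeGraph44, boxProd_adj]
  simp only [top_adj]
  split_ifs <;> norm_num <;> simp_all

instance : DecidableRel shrikhandeGraph.Adj := fun u v ↦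
  let s : Finset (ZMod 4 × ZMod 4) := {(1, 0), (-1, 0), (0, 1), (0, -1), (1, 1), (-1, -1)}
  decidable_of_iff (u ≠ v ∧ (u - v ∈ s ∨ v - u ∈ s)) (by
    simp only [shrikhandeGraph, circulantGraph_adj, s, Finset.mem_insert, Finset.mem_singleton,
      Set.mem_insert_iff, Set.mem_singleton_iff])

/-- A positive semidefinite zero forcing set of the Shrikhande graph with nine vertices. -/
def shrikhandeForcingSet : Finset (ZMod 4 × ZMod 4) :=
  {(0, 3), (1, 2), (2, 1), (2, 2), (2, 3), (3, 0), (3, 1), (3, 2), (3, 3)}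

lemma isPsdZeroForcingSet_shrikhandeForcingSet :
    IsPsdZeroForcingSet shrikhandeGraph (shrikhandeForcingSet : Set (ZMod 4 × ZMod 4)) := by
  intro B hSB hB
  have step (P C : Finset (ZMod 4 × ZMod 4)) (u v : ZMod 4 × ZMod 4) (hP : (P : Set _) ⊆ B)
      (h : u ∈ P ∧ v ∈ C ∧ shrikhandeGraph.Adj u v ∧
        (∀ a ∈ C, ∀ b, shrikhandeGraph.Adj a b → b ∈ P ∨ b ∈ C) ∧
        ∀ w ∈ C, shrikhandeGraph.Adj u w → w = v) : ((insert v P : Finset _) : Set _) ⊆ B := by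
    obtain ⟨hu, hv, huv, hC, huC⟩ := h
    rw [Finset.coe_insert]
    exact Set.insert_subset (hB.mem_of_unique_adj (C := C) hP hu hv huv hC huC) hP
  have step' (P : Finset (ZMod 4 × ZMod 4)) (u v : ZMod 4 × ZMod 4) := step P Pᶜ u v
  have h₁ := step' _ (2, 2) (1, 1) hSB (by decide)
  have h₂ := step' _ (3, 2) (0, 2) h₁ (by decide)
  have h₃ := step' _ (3, 3) (0, 0) h₂ (by decide)
  have h₄ := step _ {(0, 1)} (0, 0) (0, 1) h₃ (by decide)
  have h₅ := step' _ (0, 0) (1, 0) h₄ (by decide)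
  have h₆ := step' _ (0, 2) (1, 3) h₅ (by decide)
  have h₇ := step' _ (1, 0) (2, 0) h₆ (by decide)
  rw [Set.eq_univ_iff_forall]
  have hall : ∀ x, x ∈ (insert (2, 0) (insert (1, 3) (insert (1, 0) (insert (0, 1)
      (insert (0, 0) (insert (0, 2) (insert (1, 1) shrikhandeForcingSet)))))) :
      Finset (ZMod 4 × ZMod 4)) := by decide
  exact fun x ↦ h₇ (hall x)

/-- For `r ≥ 11`, the lattice graph `G₁ = K₄ □ K₄` and the Shrikhande graph `G₂` satisfy
`Z₊(G₂ □ K_r) < Z₊(G₁ □ K_r)`, and in particular `Z₊(G₁ □ K_r) ≠ Z₊(G₂ □ K_r)`. -/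
theorem psdZfNum_lattice_ne_shrikhande (r : ℕ) (hr : 11 ≤ r) :
    psdZfNum (shrikhandeGraph □ (⊤ : SimpleGraph (Fin r))) <
      psdZfNum (latticeGraph44 □ (⊤ : SimpleGraph (Fin r))) ∧
    psdZfNum (latticeGraph44 □ (⊤ : SimpleGraph (Fin r))) ≠
      psdZfNum (shrikhandeGraph □ (⊤ : SimpleGraph (Fin r))) := by
  suffices h : psdZfNum (shrikhandeGraph □ (⊤ : SimpleGraph (Fin r))) <
      psdZfNum (latticeGraph44 □ (⊤ : SimpleGraph (Fin r))) from ⟨h, h.ne'⟩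
  obtain ⟨n, rfl⟩ : ∃ n, r = n + 1 := ⟨r - 1, by omega⟩
  obtain ⟨S, hS, hcard⟩ :=
    exists_isPsdZeroForcingSet_card_eq (latticeGraph44 □ (⊤ : SimpleGraph (Fin (n + 1))))
  have hlow := hS.card_ge_boxProd_top isOrthogonalRep_latticeRep
  have hup : psdZfNum (shrikhandeGraph □ (⊤ : SimpleGraph (Fin (n + 1)))) ≤
      (shrikhandeForcingSet ×ˢ (Finset.univ : Finset (Fin (n + 1)))).card := by
    refine IsPsdZeroForcingSet.psdZfNum_le ?_
    simpa using isPsdZeroForcingSet_shrikhandeForcingSet.boxProd ⊤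
  have hcardT : shrikhandeForcingSet.card = 9 := by decide
  rw [Finset.card_product, hcardT, Finset.card_univ, Fintype.card_fin] at hup
  simp only [Fintype.card_prod, Fintype.card_sum, Fintype.card_fin] at hlow
  omega
end

section
/- Let G and G' be graphs of orders n and n' whose Laplacian matrices have eigenvalues λ_1 ≤ λ_2 ≤ … ≤ λ_n and λ'_1 ≤ λ'_2 ≤ … ≤ λ'_{n'}, respectively (so λ_1 = λ'_1 = 0). Then the Laplacian matrix of the join G ∨ G' has eigenvalues λ_2 + n', …, λ_n + n', λ'_2 + n, …, λ'_{n'} + n, n + n', and 0. -/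
open SimpleGraph Matrix Polynomial Finset
open scoped Classical

/-- The join of two graphs: their disjoint union together with all edges between the
two parts. -/
def graphJoin {V W : Type*} (G : SimpleGraph V) (H : SimpleGraph W) :
    SimpleGraph (V ⊕ W) :=
  SimpleGraph.fromRel (fun x y =>
    match x, y with
    | Sum.inl a, Sum.inl b => G.Adj a b
    | Sum.inr a, Sum.inr b => H.Adj a b
    | Sum.inl _, Sum.inr _ => True
    | Sum.inr _, Sum.inl _ => False)

theorem graphJoin_adj_inl_inl {V W : Type*} (G : SimpleGraph V) (H : SimpleGraph W) (a b : V) :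
    (graphJoin G H).Adj (Sum.inl a) (Sum.inl b) ↔ G.Adj a b := by
  simp only [graphJoin, SimpleGraph.fromRel_adj, G.adj_comm b a, or_self, ne_eq, Sum.inl.injEq]
  exact ⟨And.right, fun h => ⟨h.ne, h⟩⟩

theorem graphJoin_adj_inr_inr {V W : Type*} (G : SimpleGraph V) (H : SimpleGraph W) (a b : W) :
    (graphJoin G H).Adj (Sum.inr a) (Sum.inr b) ↔ H.Adj a b := by
  simp only [graphJoin, SimpleGraph.fromRel_adj, H.adj_comm b a, or_self, ne_eq, Sum.inr.injEq]
  exact ⟨And.right, fun h => ⟨h.ne, h⟩⟩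

theorem graphJoin_adj_inl_inr {V W : Type*} (G : SimpleGraph V) (H : SimpleGraph W)
    (a : V) (b : W) : (graphJoin G H).Adj (Sum.inl a) (Sum.inr b) := by
  simp [graphJoin]

theorem graphJoin_adj_inr_inl {V W : Type*} (G : SimpleGraph V) (H : SimpleGraph W)
    (a : W) (b : V) : (graphJoin G H).Adj (Sum.inr a) (Sum.inl b) := by
  simp [graphJoin]

/-- The Laplacian matrix of a join, in block form. -/
theorem lapMatrix_graphJoin {V W : Type*} [Fintype V] [Fintype W] [DecidableEq V] [DecidableEq W]
    (G : SimpleGraph V) (H : SimpleGraph W) :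
    (graphJoin G H).lapMatrix ℝ =
      fromBlocks (G.lapMatrix ℝ + (Fintype.card W : ℝ) • 1) (-of fun _ _ => 1)
        (-of fun _ _ => 1) (H.lapMatrix ℝ + (Fintype.card V : ℝ) • 1) := by
  ext (i | i) (j | j)
  · rcases eq_or_ne i j with rfl | hij
    · simp [lapMatrix, degMatrix, degree_eq_sum_if_adj, Fintype.sum_sum_type,
        graphJoin_adj_inl_inl, graphJoin_adj_inl_inr, -Finset.sum_boole]
    · simp [lapMatrix, degMatrix, graphJoin_adj_inl_inl, hij]
  · simp [lapMatrix, degMatrix, graphJoin_adj_inl_inr]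
  · simp [lapMatrix, degMatrix, graphJoin_adj_inr_inl]
  · rcases eq_or_ne i j with rfl | hij
    · simp [lapMatrix, degMatrix, degree_eq_sum_if_adj, Fintype.sum_sum_type,
        graphJoin_adj_inr_inr, graphJoin_adj_inr_inl, add_comm, -Finset.sum_boole]
    · simp [lapMatrix, degMatrix, graphJoin_adj_inr_inr, hij]

/-- A rank one update of a matrix with constant row sums by a constant matrix. -/
theorem det_sub_const_of_row_sums {K m : Type*} [Field K] [Fintype m] [DecidableEq m]
    (D : Matrix m m K) {d : K} (hd : d ≠ 0) (hD : ∀ i, ∑ j, D i j = d) (c : K) :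
    (D - of fun _ _ => c).det = D.det * (1 - c * Fintype.card m / d) := by
  have h : D - (of fun _ _ => c) =
      D * (1 + replicateCol Unit (fun _ => -(c / d)) * replicateRow Unit (fun _ => (1 : K))) := by
    rw [Matrix.mul_add, Matrix.mul_one, sub_eq_add_neg]
    congr 1
    ext i j
    simp [mul_apply, ← Finset.sum_mul, hD]
    field_simp
  rw [h, det_mul, det_one_add_replicateCol_mul_replicateRow]
  simp [dotProduct]
  ring_nf
  simp

/-- The determinant of a block matrix with constant row sums in the diagonal blocks and all
off-diagonal blocks filled with ones. -/
theorem det_fromBlocks_ones_of_row_sums {K m l : Type*} [Field K] [Fintype m] [DecidableEq m]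
    [Fintype l] [DecidableEq l] (A : Matrix m m K) (D : Matrix l l K) {a d : K}
    (ha : a ≠ 0) (hd : d ≠ 0) (hA : ∀ i, ∑ j, A i j = a) (hD : ∀ i, ∑ j, D i j = d) :
    a * d * (fromBlocks A (of fun _ _ => 1) (of fun _ _ => 1) D).det =
      A.det * D.det * (a * d - Fintype.card m * Fintype.card l) := by
  have h : fromBlocks A (of fun _ _ => 1) (of fun _ _ => 1) D *
      fromBlocks 1 (of fun _ _ => -a⁻¹) 0 1 =
      fromBlocks A 0 (of fun _ _ => 1) (D - of fun _ _ => (Fintype.card m : K) / a) := by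
    rw [fromBlocks_multiply]
    congr 1
    · simp
    · ext i j
      simp [mul_apply, ← Finset.sum_mul, hA, ha]
    · simp
    · ext i j
      simp [mul_apply]
      ring
  have h' := congrArg det h
  rw [det_mul, det_fromBlocks_zero₂₁, det_fromBlocks_zero₁₂, det_one, det_one, mul_one, mul_one,
    det_sub_const_of_row_sums D hd hD] at h'
  rw [h']
  field_simp

theorem sum_scalar_sub_lapMatrix {V : Type*} [Fintype V] [DecidableEq V] (G : SimpleGraph V)
    (x : ℝ) (i : V) : ∑ j, (scalar V x - G.lapMatrix ℝ) i j = x := by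
  have h := congrFun (G.lapMatrix_mulVec_const_eq_zero (R := ℝ)) i
  simp only [mulVec, dotProduct, mul_one, Pi.zero_apply] at h
  simp [Finset.sum_sub_distrib, h, diagonal_apply]

/-- The characteristic polynomial of the Laplacian of a join, up to the factors contributed by
the all-ones vectors of the two parts. -/
theorem mul_eval_charpoly_lapMatrix_graphJoin {V W : Type*} [Fintype V] [Fintype W]
    [DecidableEq V] [DecidableEq W] (G : SimpleGraph V) (H : SimpleGraph W) {x : ℝ}
    (hW : x - Fintype.card W ≠ 0) (hV : x - Fintype.card V ≠ 0) :
    (x - Fintype.card W) * (x - Fintype.card V) *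
        ((graphJoin G H).lapMatrix ℝ).charpoly.eval x =
      (G.lapMatrix ℝ).charpoly.eval (x - Fintype.card W) *
        (H.lapMatrix ℝ).charpoly.eval (x - Fintype.card V) *
        ((x - Fintype.card V - Fintype.card W) * x) := by
  have h : scalar (V ⊕ W) x - (graphJoin G H).lapMatrix ℝ =
      fromBlocks (scalar V (x - Fintype.card W) - G.lapMatrix ℝ) (of fun _ _ => 1)
        (of fun _ _ => 1) (scalar W (x - Fintype.card V) - H.lapMatrix ℝ) := by
    rw [lapMatrix_graphJoin]
    ext (i | i) (j | j) <;> simp [diagonal_apply, one_apply] <;> split_ifs <;> ring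
  rw [eval_charpoly, eval_charpoly, eval_charpoly, h,
    det_fromBlocks_ones_of_row_sums _ _ hW hV (sum_scalar_sub_lapMatrix G _)
      (sum_scalar_sub_lapMatrix H _)]
  ring

/-- If the Laplacian eigenvalues of `G` (of order `n`) are `0 = λ_1 ≤ … ≤ λ_n` and the
Laplacian eigenvalues of `G'` (of order `n'`) are `0 = λ'_1 ≤ … ≤ λ'_{n'}`, then the
Laplacian eigenvalues of the join `G ∨ G'` are
`λ_2 + n', …, λ_n + n', λ'_2 + n, …, λ'_{n'} + n, n + n', 0`. -/
theorem lapMatrix_charpoly_graphJoin {n n' : ℕ} [NeZero n] [NeZero n']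
    (G : SimpleGraph (Fin n)) (G' : SimpleGraph (Fin n'))
    (lam : Fin n → ℝ) (lam' : Fin n' → ℝ)
    (hmono : Monotone lam) (hmono' : Monotone lam')
    (h0 : lam 0 = 0) (h0' : lam' 0 = 0)
    (hchar : (G.lapMatrix ℝ).charpoly = ∏ i, (X - C (lam i)))
    (hchar' : (G'.lapMatrix ℝ).charpoly = ∏ j, (X - C (lam' j))) :
    ((graphJoin G G').lapMatrix ℝ).charpoly =
      (∏ i ∈ Finset.univ.erase (0 : Fin n), (X - C (lam i + n'))) *
      (∏ j ∈ Finset.univ.erase (0 : Fin n'), (X - C (lam' j + n))) *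
      (X - C ((n : ℝ) + n')) * (X - C 0) := by
  have hne : (X - C (n' : ℝ)) * (X - C (n : ℝ)) ≠ 0 :=
    mul_ne_zero (X_sub_C_ne_zero _) (X_sub_C_ne_zero _)
  refine mul_left_cancel₀ hne (Polynomial.funext fun x => ?_)
  by_cases hW : x - (n' : ℝ) = 0
  · simp [hW]
  by_cases hV : x - (n : ℝ) = 0
  · simp [hV]
  have key := mul_eval_charpoly_lapMatrix_graphJoin G G' (x := x) (by simpa using hW)
    (by simpa using hV)
  rw [hchar, hchar', ← Finset.mul_prod_erase _ _ (Finset.mem_univ (0 : Fin n)),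
    ← Finset.mul_prod_erase _ _ (Finset.mem_univ (0 : Fin n')), h0, h0'] at key
  simp only [Fintype.card_fin, eval_mul, eval_sub, eval_X, eval_C, eval_prod, sub_zero] at key ⊢
  rw [key]
  simp only [sub_sub, add_comm]
  ring
end

section
/- Let k ≥ 2 and let H be the k-regular circulant graph with vertex set {0, 1, …, 3k-2}, where vertex i is adjacent to the vertices k+i, k+i+1, …, 2k+i-1 (all taken mod 3k-1). Then Z(H) = 2k - 2. -/
open SimpleGraph Matrix
open scoped Classical


/-- The `k`-regular circulant graph on vertex set `{0, 1, …, 3k-2} = ℤ/(3k-1)` in which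
vertex `i` is adjacent to `k+i, k+i+1, …, 2k+i-1` (mod `3k-1`). -/
def circulantH (k : ℕ) : SimpleGraph (ZMod (3 * k - 1)) :=
  SimpleGraph.circulantGraph
    {x : ZMod (3 * k - 1) | ∃ t : ℕ, k ≤ t ∧ t ≤ 2 * k - 1 ∧ x = (t : ZMod (3 * k - 1))}

lemma circulantH_adj_iff {k : ℕ} (hk : 2 ≤ k) (x y : ZMod (3 * k - 1)) :
    (circulantH k).Adj x y ↔ ∃ t : ℕ, k ≤ t ∧ t ≤ 2 * k - 1 ∧ y = x + t := by
  have hn : ((3 * k - 1 : ℕ) : ZMod (3 * k - 1)) = 0 := ZMod.natCast_self _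
  have hcast : ∀ t : ℕ, t ≤ 2 * k - 1 →
      ((3 * k - 1 - t : ℕ) : ZMod (3 * k - 1)) = -(t : ZMod (3 * k - 1)) := by
    intro t ht
    rw [Nat.cast_sub (by omega), hn, zero_sub]
  simp only [circulantH, circulantGraph_adj, Set.mem_ofPred_eq]
  constructor
  · rintro ⟨-, ⟨t, h1, h2, h3⟩ | ⟨t, h1, h2, h3⟩⟩
    · refine ⟨3 * k - 1 - t, by omega, by omega, ?_⟩
      rw [hcast t h2, ← h3]; ring
    · exact ⟨t, h1, h2, by rw [← h3]; ring⟩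
  · rintro ⟨t, h1, h2, rfl⟩
    refine ⟨fun h => ?_, Or.inr ⟨t, h1, h2, by ring⟩⟩
    have h0 : (t : ZMod (3 * k - 1)) = 0 := by simpa using h
    rw [ZMod.natCast_eq_zero_iff] at h0
    have := Nat.le_of_dvd (by omega) h0
    omega

lemma circulantH_adj_intCast {k : ℕ} (hk : 2 ≤ k) (x y c : ℤ)
    (h1 : k ≤ y - x + c * (3 * k - 1)) (h2 : y - x + c * (3 * k - 1) ≤ 2 * k - 1) :
    (circulantH k).Adj (x : ZMod (3 * k - 1)) (y : ZMod (3 * k - 1)) := by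
  rw [circulantH_adj_iff hk]
  obtain ⟨t, ht⟩ := Int.eq_ofNat_of_zero_le (a := y - x + c * (3 * k - 1)) (by omega)
  refine ⟨t, by omega, by omega, ?_⟩
  have hn : ((3 * k - 1 : ℕ) : ZMod (3 * k - 1)) = 0 := ZMod.natCast_self _
  rw [Nat.cast_sub (by omega)] at hn
  have h := congrArg (Int.cast : ℤ → ZMod (3 * k - 1)) ht
  push_cast at h hn
  rw [hn] at h
  rw [← h]; ring

lemma ZMod.exists_intCast_eq_mem_Ico {n : ℕ} [NeZero n] (x : ZMod n) (a : ℤ) :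
    ∃ y : ℤ, (y : ZMod n) = x ∧ a ≤ y ∧ y < a + n := by
  refine ⟨a + ((x - (a : ZMod n)).val : ℕ), by simp, by omega, ?_⟩
  have := ZMod.val_lt (x - (a : ZMod n))
  omega

lemma ZFClosed.mem_of_unique {V : Type*} {G : SimpleGraph V} {B : Set V} (hB : ZFClosed G B)
    {u v : V} (hu : u ∈ B) (huv : G.Adj u v) (h : ∀ w, G.Adj u w → w ≠ v → w ∈ B) : v ∈ B := by
  by_contra hv
  exact hv (hB u v ⟨hu, hv, huv, fun w hw hwB => by_contra fun hne => hwB (h w hw hne)⟩)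

lemma circulantH_mem_of_closed {k : ℕ} (hk : 2 ≤ k) {B : Set (ZMod (3 * k - 1))}
    (hB : ZFClosed (circulantH k) B) (i s : ℕ) (hi : (i : ZMod (3 * k - 1)) ∈ B)
    (hs1 : k ≤ s) (hs2 : s ≤ 2 * k - 1)
    (h : ∀ t, k ≤ t → t ≤ 2 * k - 1 → t ≠ s → ((i + t : ℕ) : ZMod (3 * k - 1)) ∈ B) :
    ((i + s : ℕ) : ZMod (3 * k - 1)) ∈ B := by
  refine hB.mem_of_unique hi ((circulantH_adj_iff hk _ _).2 ⟨s, hs1, hs2, by simp⟩) ?_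
  intro w hw hne
  obtain ⟨t, h1, h2, rfl⟩ := (circulantH_adj_iff hk _ _).1 hw
  have := h t h1 h2 (by rintro rfl; simp at hne)
  simpa using this

lemma circulantH_exists_isZeroForcingSet {k : ℕ} (hk : 2 ≤ k) [NeZero (3 * k - 1)] :
    ∃ S : Finset (ZMod (3 * k - 1)),
      IsZeroForcingSet (circulantH k) (S : Set _) ∧ S.card ≤ 2 * k - 2 := by
  refine ⟨(Finset.range (k - 1) ∪ Finset.Ico k (2 * k - 1)).image (Nat.cast), ?_, ?_⟩
  · intro B hSB hB
    have hS : ∀ i : ℕ, i < k - 1 ∨ (k ≤ i ∧ i < 2 * k - 1) → (i : ZMod (3 * k - 1)) ∈ B := by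
      intro i hi
      apply hSB
      simp only [Finset.coe_image]
      exact ⟨i, by simpa using hi, rfl⟩
    have hn : ∀ i : ℕ, ((3 * k - 1 + i : ℕ) : ZMod (3 * k - 1)) = i := by
      intro i
      rw [Nat.cast_add, ZMod.natCast_self, zero_add]
    have hmid : ∀ j : ℕ, j ≤ k - 1 → ∀ x : ℕ, k ≤ x → x < 2 * k - 1 + j →
        (x : ZMod (3 * k - 1)) ∈ B := by
      intro j
      induction j with
      | zero => intro _ x h1 h2; exact hS x (Or.inr ⟨h1, h2⟩)
      | succ j ih =>
        intro hj x h1 h2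
        by_cases hx : x < 2 * k - 1 + j
        · exact ih (by omega) x h1 hx
        · obtain rfl : x = j + (2 * k - 1) := by omega
          exact circulantH_mem_of_closed hk hB j (2 * k - 1) (hS j (Or.inl (by omega)))
            (by omega) le_rfl fun t _ _ _ => ih (by omega) _ (by omega) (by omega)
    have hlast : ((3 * k - 2 : ℕ) : ZMod (3 * k - 1)) ∈ B := by
      have := circulantH_mem_of_closed hk hB k (2 * k - 2) (hS k (Or.inr (by omega)))
        (by omega) (by omega) fun t h1 h2 h3 => by
          by_cases ht : t = 2 * k - 1
          · rw [show k + t = 3 * k - 1 + 0 by omega, hn]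
            exact hS 0 (Or.inl (by omega))
          · exact hmid (k - 1) le_rfl _ (by omega) (by omega)
      rwa [show k + (2 * k - 2) = 3 * k - 2 by omega] at this
    have hgap : ((k - 1 : ℕ) : ZMod (3 * k - 1)) ∈ B := by
      have := circulantH_mem_of_closed hk hB (2 * k - 1) (2 * k - 1)
        (hmid (k - 1) le_rfl _ (by omega) (by omega))
        (by omega) (by omega) fun t h1 h2 h3 => by
          rw [show 2 * k - 1 + t = 3 * k - 1 + (t - k) by omega, hn]
          exact hS _ (Or.inl (by omega))
      rwa [show 2 * k - 1 + (2 * k - 1) = 3 * k - 1 + (k - 1) by omega, hn] at this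
    refine Set.eq_univ_of_forall fun x => ?_
    have hx := ZMod.val_lt x
    rw [← ZMod.natCast_zmod_val x]
    generalize x.val = m at hx
    by_cases h1 : m < k - 1
    · exact hS m (Or.inl h1)
    by_cases h2 : m = k - 1
    · rwa [h2]
    by_cases h3 : m = 3 * k - 2
    · rwa [h3]
    exact hmid (k - 1) le_rfl m (by omega) (by omega)
  · refine Finset.card_image_le.trans ((Finset.card_union_le _ _).trans ?_)
    simp only [Finset.card_range, Nat.card_Ico]
    omega

/-- Here `W` is the set of white vertices, and `U` is a set of vertices with no white neighbor,
contained in the arc from `a` to `a + d`. -/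
structure CirculantHArc (k : ℕ) (U W : Finset (ZMod (3 * k - 1))) (a d : ℤ) : Prop where
  nonneg : 0 ≤ d
  le : d ≤ k - 1
  left_mem : (a : ZMod (3 * k - 1)) ∈ U
  right_mem : ((a + d : ℤ) : ZMod (3 * k - 1)) ∈ U
  subset : ∀ u ∈ U, ∃ e : ℤ, 0 ≤ e ∧ e ≤ d ∧ u = ((a + e : ℤ) : ZMod (3 * k - 1))
  disjoint : ∀ u ∈ U, u ∉ W
  not_adj : ∀ u ∈ U, ∀ w ∈ W, ¬ (circulantH k).Adj u w

lemma CirculantHArc.card_le {k : ℕ} {U W : Finset (ZMod (3 * k - 1))} {a d : ℤ}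
    (h : CirculantHArc k U W a d) : U.card ≤ k := by
  have hsub : U ⊆ (Finset.Icc a (a + d)).image (Int.cast : ℤ → ZMod (3 * k - 1)) := by
    intro u hu
    obtain ⟨e, h1, h2, rfl⟩ := h.subset u hu
    exact Finset.mem_image_of_mem _ (Finset.mem_Icc.2 ⟨by omega, by omega⟩)
  have := (Finset.card_le_card hsub).trans Finset.card_image_le
  have h1 := h.le
  have h2 := h.nonneg
  rw [Int.card_Icc] at this
  omega

/-- If the arc is far from a forcing vertex `z`, then there are few white vertices. -/
lemma CirculantHArc.card_add_card_le {k : ℕ} (hk : 2 ≤ k) [NeZero (3 * k - 1)]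
    {U W : Finset (ZMod (3 * k - 1))} {a d : ℤ} (h : CirculantHArc k U W a d)
    {z : ℤ} (hz1 : a + k ≤ z) (hz2 : z ≤ a + d + 2 * k - 1)
    (hz : ∀ w ∈ W, ¬ (circulantH k).Adj (z : ZMod (3 * k - 1)) w) :
    U.card + W.card ≤ k := by
  have hd0 := h.nonneg
  have hdk := h.le
  have hU : ∀ u ∈ U, ∃ y : ℤ, (y : ZMod (3 * k - 1)) = u ∧ a ≤ y ∧ y ≤ a + d := by
    intro u hu
    obtain ⟨e, h1, h2, rfl⟩ := h.subset u hu
    exact ⟨a + e, rfl, by omega, by omega⟩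
  have hW : ∀ w ∈ W, ∃ y : ℤ, (y : ZMod (3 * k - 1)) = w ∧ a + d - k + 1 ≤ y ∧ y ≤ a + k - 1 ∧
      (y < z - 2 * k + 1 ∨ z - k < y) := by
    intro w hw
    obtain ⟨y, rfl, h1, h2⟩ := ZMod.exists_intCast_eq_mem_Ico w (a + d - k + 1)
    have ha : ¬ (k ≤ y - a + 0 * (3 * k - 1) ∧ y - a + 0 * (3 * k - 1) ≤ 2 * k - 1) := fun hc =>
      h.not_adj _ h.left_mem _ hw (circulantH_adj_intCast hk a y 0 hc.1 hc.2)
    have hb : ¬ (k ≤ y - (a + d) + 0 * (3 * k - 1) ∧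
        y - (a + d) + 0 * (3 * k - 1) ≤ 2 * k - 1) := fun hc =>
      h.not_adj _ h.right_mem _ hw (circulantH_adj_intCast hk (a + d) y 0 hc.1 hc.2)
    have hc : ¬ (k ≤ y - z + 1 * (3 * k - 1) ∧ y - z + 1 * (3 * k - 1) ≤ 2 * k - 1) := fun hc =>
      hz _ hw (circulantH_adj_intCast hk z y 1 hc.1 hc.2)
    exact ⟨y, rfl, by omega, by omega, by omega⟩
  have key : ∀ T : Finset ℤ, T.card ≤ k →
      (∀ y : ℤ, a ≤ y → y ≤ a + d → y ∈ T) →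
      (∀ y : ℤ, a + d - k + 1 ≤ y → y ≤ a + k - 1 → (y < z - 2 * k + 1 ∨ z - k < y) → y ∈ T) →
      U.card + W.card ≤ k := by
    intro T hT h1 h2
    rw [← Finset.card_union_of_disjoint (Finset.disjoint_left.2 h.disjoint)]
    have hsub : U ∪ W ⊆ T.image (Int.cast : ℤ → ZMod (3 * k - 1)) := by
      intro x hx
      rcases Finset.mem_union.1 hx with hx | hx
      · obtain ⟨y, rfl, h3, h4⟩ := hU x hx
        exact Finset.mem_image_of_mem _ (h1 y h3 h4)
      · obtain ⟨y, rfl, h3, h4, h5⟩ := hW x hx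
        exact Finset.mem_image_of_mem _ (h2 y h3 h4 h5)
    exact ((Finset.card_le_card hsub).trans Finset.card_image_le).trans hT
  by_cases hlo : z < a + d + k
  · refine key (Finset.Icc a (a + k - 1)) (by rw [Int.card_Icc]; omega) ?_ ?_ <;>
      intros <;> rw [Finset.mem_Icc] <;> omega
  by_cases hhi : a + 2 * k ≤ z
  · refine key (Finset.Icc (a + d - k + 1) (a + d)) (by rw [Int.card_Icc]; omega) ?_ ?_ <;>
      intros <;> rw [Finset.mem_Icc] <;> omega
  · refine key (Finset.Icc (a + d - k + 1) (z - 2 * k) ∪ Finset.Icc a (a + d) ∪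
      Finset.Icc (z - k + 1) (a + k - 1)) ?_ ?_ ?_
    · refine (Finset.card_union_le _ _).trans
        ((Nat.add_le_add_right (Finset.card_union_le _ _) _).trans ?_)
      simp only [Int.card_Icc]
      omega
    all_goals
      intros
      simp only [Finset.mem_union, Finset.mem_Icc]
      omega

lemma CirculantHArc.step {k : ℕ} (hk : 2 ≤ k) [NeZero (3 * k - 1)]
    {U W : Finset (ZMod (3 * k - 1))} {a d : ℤ} (h : CirculantHArc k U W a d)
    (hcard : k + 2 ≤ U.card + W.card) {z v : ZMod (3 * k - 1)} (hzW : z ∉ W) (hv : v ∈ W)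
    (hz : ∀ w ∈ W, (circulantH k).Adj z w → w = v) :
    ∃ a' d' : ℤ, CirculantHArc k (insert z U) (W.erase v) a' d' := by
  have hd0 := h.nonneg
  have hdk := h.le
  have hdisj : ∀ u ∈ insert z U, u ∉ W.erase v := by
    intro u hu huW
    rcases Finset.mem_insert.1 hu with rfl | hu
    · exact hzW (Finset.mem_of_mem_erase huW)
    · exact h.disjoint u hu (Finset.mem_of_mem_erase huW)
  have hz' : ∀ w ∈ W.erase v, ¬ (circulantH k).Adj z w := fun w hw hadj =>
    Finset.ne_of_mem_erase hw (hz w (Finset.mem_of_mem_erase hw) hadj)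
  have hnadj : ∀ u ∈ insert z U, ∀ w ∈ W.erase v, ¬ (circulantH k).Adj u w := by
    intro u hu w hw
    rcases Finset.mem_insert.1 hu with rfl | hu
    · exact hz' w hw
    · exact h.not_adj u hu w (Finset.mem_of_mem_erase hw)
  obtain ⟨y, rfl, hy1, hy2⟩ := ZMod.exists_intCast_eq_mem_Ico z a
  have hleft := Finset.mem_insert_of_mem (b := (y : ZMod (3 * k - 1))) h.left_mem
  have hright := Finset.mem_insert_of_mem (b := (y : ZMod (3 * k - 1))) h.right_mem
  by_cases c1 : y ≤ a + d
  · refine ⟨a, d, hd0, hdk, hleft, hright, fun u hu => ?_, hdisj, hnadj⟩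
    rcases Finset.mem_insert.1 hu with rfl | hu
    · exact ⟨y - a, by omega, by omega, by simp⟩
    · exact h.subset u hu
  by_cases c2 : y ≤ a + k - 1
  · refine ⟨a, y - a, by omega, by omega, hleft, by simp, fun u hu => ?_, hdisj, hnadj⟩
    rcases Finset.mem_insert.1 hu with rfl | hu
    · exact ⟨y - a, by omega, by omega, by simp⟩
    · obtain ⟨e, h1, h2, rfl⟩ := h.subset u hu
      exact ⟨e, h1, by omega, rfl⟩
  by_cases c3 : a + d + 2 * k ≤ y
  · have hcast : ((y - (3 * k - 1 : ℕ) : ℤ) : ZMod (3 * k - 1)) = y := by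
      rw [Int.cast_sub, Int.cast_natCast, ZMod.natCast_self, sub_zero]
    refine ⟨y - (3 * k - 1 : ℕ), a + d - (y - (3 * k - 1 : ℕ)), by omega, by omega, ?_, ?_,
      fun u hu => ?_, hdisj, hnadj⟩
    · rw [hcast]; exact Finset.mem_insert_self _ _
    · rwa [add_sub_cancel]
    · rcases Finset.mem_insert.1 hu with rfl | hu
      · exact ⟨0, by omega, by omega, by rw [add_zero, hcast]⟩
      · obtain ⟨e, h1, h2, rfl⟩ := h.subset u hu
        exact ⟨a + e - (y - (3 * k - 1 : ℕ)), by omega, by omega, by rw [add_sub_cancel]⟩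
  · have harc : CirculantHArc k U (W.erase v) a d :=
      ⟨hd0, hdk, h.left_mem, h.right_mem, h.subset,
        fun u hu => hdisj u (Finset.mem_insert_of_mem hu),
        fun u hu => hnadj u (Finset.mem_insert_of_mem hu)⟩
    have := harc.card_add_card_le hk (z := y) (by omega) (by omega) hz'
    have := Finset.card_erase_add_one hv
    omega

/-- A zero forcing set admits a force from every proper superset of it. -/
lemma IsZeroForcingSet.exists_stdForce {V : Type*} {G : SimpleGraph V} {S B : Set V}
    (hS : IsZeroForcingSet G S) (hSB : S ⊆ B) (hB : B ≠ Set.univ) :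
    ∃ u v, StdForce G B u v := by
  by_contra! hne
  exact hB (hS B hSB fun u v huv => absurd huv (hne u v))

lemma CirculantHArc.not_isZeroForcingSet {k : ℕ} (hk : 2 ≤ k) [NeZero (3 * k - 1)]
    {U W : Finset (ZMod (3 * k - 1))} {a d : ℤ} (h : CirculantHArc k U W a d)
    (hcard : k + 2 ≤ U.card + W.card) {S : Set (ZMod (3 * k - 1))}
    (hSW : S ⊆ (W : Set (ZMod (3 * k - 1)))ᶜ) : ¬ IsZeroForcingSet (circulantH k) S := by
  intro hS
  induction hm : W.card generalizing U W a d with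
  | zero =>
    have := h.card_le
    omega
  | succ m ih =>
    have hne : (W : Set (ZMod (3 * k - 1)))ᶜ ≠ Set.univ := by
      intro h0
      rw [Set.compl_univ_iff, Finset.coe_eq_empty] at h0
      simp [h0] at hm
    obtain ⟨z, v, hzW, hv, hzv, huniq⟩ := hS.exists_stdForce hSW hne
    simp only [Set.mem_compl_iff, Finset.mem_coe, not_not] at hzW hv huniq
    obtain ⟨a', d', h'⟩ := h.step hk hcard hzW hv fun w hw hadj => huniq w hadj hw
    have hzU : z ∉ U := fun hzU => h.not_adj z hzU v hv hzv
    have h1 := Finset.card_insert_of_notMem hzU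
    have h2 := Finset.card_erase_add_one hv
    refine ih h' (by omega) (hSW.trans ?_) (by omega)
    exact Set.compl_subset_compl.2 (Finset.coe_subset.2 (Finset.erase_subset _ _))

lemma circulantH_le_card_of_isZeroForcingSet {k : ℕ} (hk : 2 ≤ k) [NeZero (3 * k - 1)]
    {S : Finset (ZMod (3 * k - 1))} (hS : IsZeroForcingSet (circulantH k) (S : Set _)) :
    2 * k - 2 ≤ S.card := by
  by_contra! hlt
  have hc : Sᶜ.card = 3 * k - 1 - S.card := by rw [Finset.card_compl, ZMod.card]
  have hne : (S : Set (ZMod (3 * k - 1))) ≠ Set.univ := by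
    intro h0
    rw [Finset.coe_eq_univ] at h0
    rw [h0, Finset.compl_univ, Finset.card_empty, ← h0] at hc
    omega
  obtain ⟨z, v, hz, hv, -, huniq⟩ := hS.exists_stdForce subset_rfl hne
  obtain ⟨y, rfl, -, -⟩ := ZMod.exists_intCast_eq_mem_Ico z 0
  have hv' : v ∈ Sᶜ := by simpa using hv
  have harc : CirculantHArc k {(y : ZMod (3 * k - 1))} (Sᶜ.erase v) y 0 := by
    refine ⟨le_rfl, by omega, by simp, by simp, fun u hu => ⟨0, by simpa using hu⟩, ?_, ?_⟩
    · intro u hu huW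
      rw [Finset.mem_singleton.1 hu] at huW
      exact Finset.mem_compl.1 (Finset.mem_of_mem_erase huW) hz
    · intro u hu w hw hadj
      rw [Finset.mem_singleton.1 hu] at hadj
      exact Finset.ne_of_mem_erase hw
        (huniq w hadj (Finset.mem_compl.1 (Finset.mem_of_mem_erase hw)))
  have := Finset.card_erase_add_one hv'
  refine harc.not_isZeroForcingSet hk (by rw [Finset.card_singleton]; omega) ?_ hS
  intro x hx hxW
  exact Finset.mem_compl.1 (Finset.mem_of_mem_erase hxW) hx

/-- For `k ≥ 2`, the circulant graph `H` above satisfies `Z(H) = 2k - 2`. -/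
theorem zfNum_circulantH (k : ℕ) (hk : 2 ≤ k) [NeZero (3 * k - 1)] :
    zfNum (circulantH k) = 2 * k - 2 := by
  obtain ⟨S, hS, hcard⟩ := circulantH_exists_isZeroForcingSet hk
  unfold zfNum
  refine le_antisymm (le_trans (Nat.sInf_le ⟨S, hS, rfl⟩) hcard) (le_csInf ⟨_, S, hS, rfl⟩ ?_)
  rintro _ ⟨T, hT, rfl⟩
  exact circulantH_le_card_of_isZeroForcingSet hk hT
end

section
/- Let k ≥ 1 and let L_k be the bipartite graph with partite sets {v_1, …, v_k} and {w_1, …, w_k}, where v_i is adjacent to w_j if and only if j ≤ i. Let S be a set of vertices of L_k of size s, colored blue, with all other vertices white, and assume that s ≤ k-1 if some vertex of S has all of its neighbors in S, and s ≤ k-2 otherwise. Then in the standard zero forcing process started from S, no vertex that gets forced (i.e., no vertex outside S that becomes blue) ever performs a force: every force in the process is performed by a vertex of S. -/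
open SimpleGraph Matrix


/-- `ZFDerives G B C` : the blue set `C` can be obtained from the blue set `B` by a
(possibly empty) sequence of applications of the standard color change rule. -/
inductive ZFDerives {V : Type*} (G : SimpleGraph V) : Set V → Set V → Prop
  | refl (B : Set V) : ZFDerives G B B
  | step {B C : Set V} {u v : V} :
      ZFDerives G B C → StdForce G C u v → ZFDerives G B (insert v C)

/-- The bipartite graph `L_k` with parts `{v_1, …, v_k}` (left) and `{w_1, …, w_k}`
(right), where `v_i ∼ w_j` if and only if `j ≤ i`. -/
def bipartiteL (k : ℕ) : SimpleGraph (Fin k ⊕ Fin k) :=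
  SimpleGraph.fromRel (fun x y =>
    match x, y with
    | Sum.inl i, Sum.inr j => (j : ℕ) ≤ (i : ℕ)
    | _, _ => False)

/-- `f` assigns to each forced vertex of `B` (one outside `S`) the vertex of `S` that forced it:
all neighbors of `f x` are blue, and of two distinct forced vertices the one forced later was not
adjacent to the forcer of the other. -/
structure IsForcerMap {V : Type*} (G : SimpleGraph V) (S : Finset V) (B : Set V)
    (f : V → V) : Prop where
  mem : ∀ x ∈ B, x ∉ S → f x ∈ S
  adj : ∀ x ∈ B, x ∉ S → G.Adj (f x) x
  blue : ∀ x ∈ B, x ∉ S → ∀ z, G.Adj (f x) z → z ∈ B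
  chron : ∀ x ∈ B, x ∉ S → ∀ y ∈ B, y ∉ S → x ≠ y → G.Adj (f x) y → ¬ G.Adj (f y) x

theorem IsForcerMap.step {V : Type*} [DecidableEq V] {G : SimpleGraph V} {S : Finset V}
    {B : Set V} {f : V → V} (hf : IsForcerMap G S B f) {u v : V} (h : StdForce G B u v)
    (hu : u ∈ S) : IsForcerMap G S (insert v B) (Function.update f v u) := by
  obtain ⟨-, hvB, huv, huniq⟩ := h
  have old : ∀ x ∈ insert v B, x ≠ v → x ∈ B ∧ Function.update f v u x = f x :=
    fun x hx hxv => ⟨hx.resolve_left hxv, Function.update_of_ne hxv _ _⟩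
  constructor
  · intro x hx hxS
    by_cases hxv : x = v
    · subst hxv; simpa using hu
    · obtain ⟨hxB, e⟩ := old x hx hxv
      exact e ▸ hf.mem x hxB hxS
  · intro x hx hxS
    by_cases hxv : x = v
    · subst hxv; simpa using huv
    · obtain ⟨hxB, e⟩ := old x hx hxv
      exact e ▸ hf.adj x hxB hxS
  · intro x hx hxS z hz
    by_cases hxv : x = v
    · subst hxv
      rw [Function.update_self] at hz
      by_cases hzB : z ∈ B
      · exact Or.inr hzB
      · exact Or.inl (huniq z hz hzB)
    · obtain ⟨hxB, e⟩ := old x hx hxv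
      exact Or.inr (hf.blue x hxB hxS z (e ▸ hz))
  · intro x hx hxS y hy hyS hxy h₁ h₂
    by_cases hxv : x = v
    · subst hxv
      obtain ⟨hyB, e⟩ := old y hy hxy.symm
      exact hvB (hf.blue y hyB hyS x (e ▸ h₂))
    · obtain ⟨hxB, e⟩ := old x hx hxv
      rw [e] at h₁
      by_cases hyv : y = v
      · subst hyv
        exact hvB (hf.blue x hxB hxS y h₁)
      · obtain ⟨hyB, e'⟩ := old y hy hyv
        exact hf.chron x hxB hxS y hyB hyS hxy h₁ (e' ▸ h₂)

/-- In a triangle-free graph, suppose that for every vertex `u` there are at least `k + 1` vertices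
that are adjacent to `u` or whose neighborhood contains that of `u`. If `S` is small, then a vertex
that was forced by a vertex of `S` cannot force. -/
theorem IsForcerMap.mem_of_stdForce {V : Type*} [DecidableEq V] {G : SimpleGraph V} {k : ℕ}
    (htri : ∀ x y z, G.Adj x y → G.Adj y z → ¬ G.Adj x z)
    (hT : ∀ u, ∃ T : Finset V, k + 1 ≤ T.card ∧
      ∀ x ∈ T, G.Adj u x ∨ ∀ z, G.Adj u z → G.Adj x z)
    {S : Finset V} (hk : 1 ≤ k)
    (h₁ : (∃ p ∈ S, ∀ w, G.Adj p w → w ∈ S) → S.card ≤ k - 1)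
    (h₂ : (¬ ∃ p ∈ S, ∀ w, G.Adj p w → w ∈ S) → S.card ≤ k - 2)
    {B : Set V} (hSB : ↑S ⊆ B) {f : V → V} (hf : IsForcerMap G S B f) {u a : V}
    (h : StdForce G B u a) : u ∈ S := by
  by_contra huS
  obtain ⟨huB, haB, hua, huniq⟩ := h
  have haS : a ∉ S := fun ha => haB (hSB ha)
  have hfu := hf.mem u huB huS
  have hfuadj := hf.adj u huB huS
  obtain ⟨T, hTcard, hT⟩ := hT u
  set W := (T.erase a).erase u with hW
  have hWcard : k - 1 ≤ W.card := by
    have := Finset.pred_card_le_card_erase (s := T) (a := a)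
    have := Finset.pred_card_le_card_erase (s := T.erase a) (a := u)
    rw [hW]
    omega
  have hWmem : ∀ x ∈ W, x ≠ u ∧ x ∈ B ∧ (G.Adj u x ∨ ∀ z, G.Adj u z → G.Adj x z) := by
    intro x hx
    simp only [hW, Finset.mem_erase] at hx
    obtain ⟨hxu, hxa, hxT⟩ := hx
    refine ⟨hxu, ?_, hT x hxT⟩
    rcases hT x hxT with hadj | hsub
    · by_contra hxB
      exact hxa (huniq x hadj hxB)
    · exact hf.blue u huB huS x (hsub _ hfuadj.symm).symm
  have hfW : ∀ y ∈ W, y ∉ S → f y ∉ W := by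
    intro y hy hyS hfy
    obtain ⟨hyu, hyB, hy'⟩ := hWmem y hy
    obtain ⟨-, -, hfy' | hfy'⟩ := hWmem _ hfy
    · rcases hy' with hadj | hsub
      · exact htri _ _ _ (hf.adj y hyB hyS) hadj.symm hfy'.symm
      · exact hf.chron u huB huS y hyB hyS hyu.symm (hsub _ hfuadj.symm).symm hfy'.symm
    · exact haB (hf.blue y hyB hyS a (hfy' a hua))
  set g : V → V := fun x => if x ∈ S then x else f x with hg
  have hginj : Set.InjOn g W := by
    intro x hx y hy hxy
    have hx' := hWmem x hx
    have hy' := hWmem y hy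
    by_cases hxS : x ∈ S <;> by_cases hyS : y ∈ S <;>
      simp only [hg, hxS, hyS, if_true, if_false] at hxy
    · exact hxy
    · exact (hfW y hy hyS (hxy ▸ hx)).elim
    · exact (hfW x hx hxS (hxy ▸ hy)).elim
    · by_contra hne
      exact hf.chron x hx'.2.1 hxS y hy'.2.1 hyS hne
        (hxy ▸ hf.adj y hy'.2.1 hyS) (hxy ▸ hf.adj x hx'.2.1 hxS)
  have hgS : W.image g ⊆ S := by
    intro p hp
    obtain ⟨x, hx, rfl⟩ := Finset.mem_image.1 hp
    by_cases hxS : x ∈ S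
    · simp [hg, hxS]
    · simpa [hg, hxS] using hf.mem x (hWmem x hx).2.1 hxS
  have hcard : (W.image g).card = W.card := Finset.card_image_of_injOn hginj
  have hpos : 0 < S.card := Finset.card_pos.2 ⟨_, hfu⟩
  by_cases hex : ∃ p ∈ S, ∀ w, G.Adj p w → w ∈ S
  · have hle := h₁ hex
    obtain ⟨p, hpS, hp⟩ := hex
    have hpg : p ∉ W.image g := by
      intro hpi
      obtain ⟨x, hx, hxp⟩ := Finset.mem_image.1 hpi
      obtain ⟨-, hxB, hx'⟩ := hWmem x hx
      by_cases hxS : x ∈ S <;> simp only [hg, hxS, if_true, if_false] at hxp <;> subst hxp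
      · rcases hx' with hadj | hsub
        · exact huS (hp u hadj.symm)
        · exact haS (hp a (hsub a hua))
      · exact hxS (hp x (hf.adj x hxB hxS))
    have := Finset.card_lt_card (Finset.ssubset_iff_subset_ne.2
      ⟨hgS, fun e => hpg (e ▸ hpS)⟩)
    omega
  · have := h₂ hex
    have := Finset.card_le_card hgS
    omega

theorem bipartiteL_adj_inl_inr {k : ℕ} {i j : Fin k} :
    (bipartiteL k).Adj (Sum.inl i) (Sum.inr j) ↔ j ≤ i := by
  simp [bipartiteL]

theorem bipartiteL_adj_inr_inl {k : ℕ} {i j : Fin k} :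
    (bipartiteL k).Adj (Sum.inr j) (Sum.inl i) ↔ j ≤ i := by
  simp [bipartiteL]

theorem bipartiteL_not_adj_inl_inl {k : ℕ} {i j : Fin k} :
    ¬ (bipartiteL k).Adj (Sum.inl i) (Sum.inl j) := by
  simp [bipartiteL]

theorem bipartiteL_not_adj_inr_inr {k : ℕ} {i j : Fin k} :
    ¬ (bipartiteL k).Adj (Sum.inr i) (Sum.inr j) := by
  simp [bipartiteL]

theorem bipartiteL_triangle_free {k : ℕ} (x y z : Fin k ⊕ Fin k)
    (hxy : (bipartiteL k).Adj x y) (hyz : (bipartiteL k).Adj y z) :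
    ¬ (bipartiteL k).Adj x z := by
  rcases x with x | x <;> rcases y with y | y <;> rcases z with z | z <;>
    simp_all [bipartiteL_not_adj_inl_inl, bipartiteL_not_adj_inr_inr]

theorem bipartiteL_exists_adj_or_dominating {k : ℕ} (u : Fin k ⊕ Fin k) :
    ∃ T : Finset (Fin k ⊕ Fin k), k + 1 ≤ T.card ∧
      ∀ x ∈ T, (bipartiteL k).Adj u x ∨
        ∀ z, (bipartiteL k).Adj u z → (bipartiteL k).Adj x z := by
  have hcard (i : Fin k) :
      k + 1 ≤ ((Finset.Ici i).disjSum (Finset.Iic i)).card := by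
    rw [Finset.card_disjSum, Fin.card_Ici, Fin.card_Iic]
    omega
  rcases u with i | i <;> refine ⟨_, hcard i, ?_⟩ <;> rintro (x | x) hx
  · rw [Finset.inl_mem_disjSum, Finset.mem_Ici] at hx
    right
    rintro (z | z) hz
    · exact (bipartiteL_not_adj_inl_inl hz).elim
    · exact bipartiteL_adj_inl_inr.2 ((bipartiteL_adj_inl_inr.1 hz).trans hx)
  · rw [Finset.inr_mem_disjSum, Finset.mem_Iic] at hx
    exact Or.inl (bipartiteL_adj_inl_inr.2 hx)
  · rw [Finset.inl_mem_disjSum, Finset.mem_Ici] at hx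
    exact Or.inl (bipartiteL_adj_inr_inl.2 hx)
  · rw [Finset.inr_mem_disjSum, Finset.mem_Iic] at hx
    right
    rintro (z | z) hz
    · exact bipartiteL_adj_inr_inl.2 (hx.trans (bipartiteL_adj_inr_inl.1 hz))
    · exact (bipartiteL_not_adj_inr_inr hz).elim

/-- Let `k ≥ 1` and let `S` be a set of blue vertices of `L_k` of size `s`, where
`s ≤ k-1` if some vertex of `S` has all of its neighbors in `S`, and `s ≤ k-2`
otherwise. Then in the zero forcing process started from `S`, every force is performed
by a vertex of `S`: no forced vertex ever performs a force. -/
theorem bipartiteL_forced_vertices_never_force (k : ℕ) (hk : 1 ≤ k)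
    (S : Finset (Fin k ⊕ Fin k))
    (h₁ : (∃ u ∈ S, ∀ w, (bipartiteL k).Adj u w → w ∈ S) → S.card ≤ k - 1)
    (h₂ : (¬ ∃ u ∈ S, ∀ w, (bipartiteL k).Adj u w → w ∈ S) → S.card ≤ k - 2) :
    ∀ B : Set (Fin k ⊕ Fin k), ZFDerives (bipartiteL k) (↑S) B →
      ∀ u v, StdForce (bipartiteL k) B u v → u ∈ S := by
  have key {C : Set (Fin k ⊕ Fin k)} (hSC : ↑S ⊆ C) {f : Fin k ⊕ Fin k → Fin k ⊕ Fin k}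
      (hf : IsForcerMap (bipartiteL k) S C f) {u v : Fin k ⊕ Fin k}
      (h : StdForce (bipartiteL k) C u v) : u ∈ S :=
    hf.mem_of_stdForce bipartiteL_triangle_free bipartiteL_exists_adj_or_dominating hk h₁ h₂ hSC h
  intro B hB
  suffices hinv : ↑S ⊆ B ∧ ∃ f, IsForcerMap (bipartiteL k) S B f by
    obtain ⟨hSB, f, hf⟩ := hinv
    exact fun u v h => key hSB hf h
  induction hB with
  | refl =>
    exact ⟨subset_rfl, id, ⟨fun x hx h => (h hx).elim, fun x hx h => (h hx).elim,
      fun x hx h => (h hx).elim, fun x hx h => (h hx).elim⟩⟩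
  | step _ hforce ih =>
    obtain ⟨hSC, f, hf⟩ := ih
    exact ⟨hSC.trans (Set.subset_insert _ _), _,
      hf.step hforce (key hSC hf hforce)⟩
end
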